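/- arXiv:math/0408203 — 2 statements merged into one kernel-verified Lean document; each statement's English description precedes it below -/
import Mathlib

section
/- Assume: (i) there is an open interval I ⊂ (1/m,1) such that for Lebesgue-a.e. λ ∈ I the lower correlation dimension of ν_λ equals 1; (ii) there is an open interval J ⊂ (0,1) such that no f ∈ 𝓑 has a root of multiplicity ≥ 2 in J; (iii) there is an open set R ⊂ ℝ² such that for every (γ,λ) ∈ R there is no f ∈ 𝓑 having both γ and λ as roots of multiplicity ≥ 2. Let S = (R ∩ (I×I) ∩ Γ(0,1/m)) ∪ ((J×I) ∩ Γ(0,1/m)). Then for Lebesgue-almost every (γ,λ) ∈ S, the Hausdorff dimension of K_{γ,λ} equals 1 + log(mλ)/log(1/γ). -/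
open MeasureTheory Filter Set
open scoped ENNReal Topology

noncomputable section

/-- The self-affine set `K_{γ,λ}` for a digit set `d : Fin m → ℝ`. -/
def Kaff (m : ℕ) (d : Fin m → ℝ) (g l : ℝ) : Set (ℝ × ℝ) :=
  {p | ∃ ω : ℕ → Fin m, p = (∑' n, d (ω n) * g ^ n, ∑' n, d (ω n) * l ^ n)}

/-- `Γ(a,b) = {(γ,λ) : 0 < γ < λ < 1, 1/m < λ, a < γλ < b}`. -/
def Gamma (m : ℕ) (a b : ℝ) : Set (ℝ × ℝ) :=
  {p | 0 < p.1 ∧ p.1 < p.2 ∧ p.2 < 1 ∧ 1 / (m : ℝ) < p.2 ∧ a < p.1 * p.2 ∧ p.1 * p.2 < b}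

/-- Evaluation of the power series with coefficient sequence `c` at `x`. -/
def Beval (c : ℕ → ℝ) (x : ℝ) : ℝ := ∑' n, c n * x ^ n

/-- Membership in `𝓑̃`: all coefficients lie in `D − D`. -/
def memBtilde (m : ℕ) (d : Fin m → ℝ) (c : ℕ → ℝ) : Prop :=
  ∀ n, ∃ i j, c n = d i - d j

/-- Membership in `𝓑`: all coefficients lie in `D − D` and the constant term is nonzero. -/
def memB (m : ℕ) (d : Fin m → ℝ) (c : ℕ → ℝ) : Prop :=
  memBtilde m d c ∧ c 0 ≠ 0

/-- `α` is a root of multiplicity at least 2 of the power series with coefficients `c`. -/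
def HasDoubleRootAt (c : ℕ → ℝ) (α : ℝ) : Prop :=
  Beval c α = 0 ∧ deriv (Beval c) α = 0

/-- `ρ` is the Bernoulli product measure on `(Fin m)^ℕ` with weights `p`:
a probability measure assigning to each cylinder the product of the weights. -/
def IsBernoulliWith {α : Type*} [MeasurableSpace α] (p : α → ℝ≥0∞)
    (ρ : Measure (ℕ → α)) : Prop :=
  IsProbabilityMeasure ρ ∧
    ∀ (n : ℕ) (w : Fin n → α), ρ {ω | ∀ i : Fin n, ω i.1 = w i} = ∏ i, p (w i)

/-- `Π_λ(ω) = ∑ₙ d(ωₙ) λⁿ`. -/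
def PiOne (m : ℕ) (d : Fin m → ℝ) (l : ℝ) (ω : ℕ → Fin m) : ℝ := ∑' n, d (ω n) * l ^ n

/-- Lower correlation dimension of a measure on `ℝ`. -/
def lowerCorrDim (ν : Measure ℝ) : ℝ :=
  Filter.liminf
    (fun r : ℝ => Real.log (((ν.prod ν) {p : ℝ × ℝ | |p.1 - p.2| ≤ r}).toReal) / Real.log r)
    (𝓝[>] (0 : ℝ))

/-- Truncation of a real number to `[0,q]`. -/
def clampQ (q x : ℝ) : ℝ := max 0 (min x q)

/-- Coding map with truncated parameter. -/
def FF (m : ℕ) (d : Fin m → ℝ) (q x : ℝ) (ω : ℕ → Fin m) : ℝ := ∑' n, d (ω n) * clampQ q x ^ n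

/-- Derivative of the coding map with truncated parameter. -/
def DD (m : ℕ) (d : Fin m → ℝ) (q x : ℝ) (ω : ℕ → Fin m) : ℝ :=
  ∑' n : ℕ, d (ω n) * (n * clampQ q x ^ (n - 1))

lemma clampQ_cont (q : ℝ) : Continuous (clampQ q) := by
  unfold clampQ; fun_prop

lemma clampQ_nonneg (q x : ℝ) : 0 ≤ clampQ q x := le_max_left _ _

lemma clampQ_le (q x : ℝ) (hq : 0 ≤ q) : clampQ q x ≤ q := max_le hq (min_le_right _ _)

lemma clampQ_eq {q x : ℝ} (hx : 0 ≤ x) (hxq : x ≤ q) : clampQ q x = x := by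
  unfold clampQ; rw [min_eq_left hxq, max_eq_right hx]

lemma exists_bd (m : ℕ) (d : Fin m → ℝ) : ∃ M : ℝ, 0 ≤ M ∧ ∀ i, |d i| ≤ M := by
  refine ⟨∑ i, |d i|, Finset.sum_nonneg fun i _ => abs_nonneg _, fun i => ?_⟩
  exact Finset.single_le_sum (f := fun i => |d i|) (fun i _ => abs_nonneg _) (Finset.mem_univ i)

lemma summable_deriv_geom {q : ℝ} (hq0 : 0 ≤ q) (hq1 : q < 1) :
    Summable (fun n : ℕ => (n : ℝ) * q ^ (n - 1)) := by
  have h := summable_pow_mul_geometric_of_norm_lt_one (R := ℝ) 1 (r := q)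
    (by rw [Real.norm_eq_abs, abs_of_nonneg hq0]; exact hq1)
  have h0 := summable_geometric_of_lt_one hq0 hq1
  rw [← summable_nat_add_iff 1]
  refine (h.add h0).congr fun n => ?_
  push_cast
  ring

lemma FF_continuous (m : ℕ) (d : Fin m → ℝ) {q : ℝ} (hq0 : 0 ≤ q) (hq1 : q < 1) :
    Continuous (fun p : ℝ × (ℕ → Fin m) => FF m d q p.1 p.2) := by
  obtain ⟨M, hM0, hM⟩ := exists_bd m d
  unfold FF
  refine continuous_tsum (u := fun n => M * q ^ n) (fun n => ?_)
    ((summable_geometric_of_lt_one hq0 hq1).mul_left M) (fun n p => ?_)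
  · have hc := clampQ_cont q
    have hd : Continuous d := continuous_of_discreteTopology
    fun_prop
  · rw [Real.norm_eq_abs, abs_mul, abs_of_nonneg (pow_nonneg (clampQ_nonneg q p.1) n)]
    have := clampQ_nonneg q p.1
    have := clampQ_le q p.1 hq0
    gcongr
    exact hM _

lemma DD_continuous (m : ℕ) (d : Fin m → ℝ) {q : ℝ} (hq0 : 0 ≤ q) (hq1 : q < 1) :
    Continuous (fun p : ℝ × (ℕ → Fin m) => DD m d q p.1 p.2) := by
  obtain ⟨M, hM0, hM⟩ := exists_bd m d
  unfold DD
  refine continuous_tsum (u := fun n : ℕ => M * (n * q ^ (n-1))) (fun n => ?_)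
    ((summable_deriv_geom hq0 hq1).mul_left M) (fun n p => ?_)
  · have hc := clampQ_cont q
    have hd : Continuous d := continuous_of_discreteTopology
    fun_prop
  · have h1 := clampQ_nonneg q p.1
    have := clampQ_le q p.1 hq0
    rw [Real.norm_eq_abs, abs_mul, abs_of_nonneg (mul_nonneg (Nat.cast_nonneg _) (pow_nonneg h1 _))]
    gcongr
    exact hM _

lemma FF_eq (m : ℕ) (d : Fin m → ℝ) {q x : ℝ} (hx : 0 ≤ x) (hxq : x ≤ q) (ω : ℕ → Fin m) :
    FF m d q x ω = PiOne m d x ω := by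
  unfold FF PiOne; rw [clampQ_eq hx hxq]

lemma PiOne_summable (m : ℕ) (d : Fin m → ℝ) {x : ℝ} (hx : 0 ≤ x) (hx1 : x < 1) (ω : ℕ → Fin m) :
    Summable (fun n => d (ω n) * x ^ n) := by
  obtain ⟨M, hM0, hM⟩ := exists_bd m d
  refine Summable.of_norm_bounded (g := fun n => M * x ^ n)
    ((summable_geometric_of_lt_one hx hx1).mul_left M) (fun n => ?_)
  rw [Real.norm_eq_abs, abs_mul, abs_of_nonneg (pow_nonneg hx n)]
  gcongr
  exact hM _

lemma PiOne_continuous (m : ℕ) (d : Fin m → ℝ) {x : ℝ} (hx : 0 ≤ x) (hx1 : x < 1) :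
    Continuous (PiOne m d x) := by
  have h := (FF_continuous m d hx hx1).comp (Continuous.prodMk_right x)
  refine h.congr fun ω => ?_
  exact FF_eq m d hx le_rfl ω

lemma PiOne_hasDerivAt (m : ℕ) (d : Fin m → ℝ) {q x : ℝ} (hq1 : q < 1) (hx : 0 < x) (hxq : x < q)
    (ω : ℕ → Fin m) : HasDerivAt (fun z => PiOne m d z ω) (DD m d q x ω) x := by
  obtain ⟨M, hM0, hM⟩ := exists_bd m d
  have hq0 : 0 ≤ q := by linarith
  have h := hasDerivAt_tsum_of_isPreconnected (𝕜 := ℝ) (F := ℝ)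
    (u := fun n : ℕ => M * (n * q ^ (n-1))) (t := Ioo 0 q) (y₀ := x) (y := x)
    (g := fun n z => d (ω n) * z ^ n) (g' := fun n z => d (ω n) * (n * z ^ (n-1)))
    ((summable_deriv_geom hq0 hq1).mul_left M) isOpen_Ioo isPreconnected_Ioo
    (fun n y _ => (hasDerivAt_pow n y).const_mul _) ?_ ⟨hx, hxq⟩
    (PiOne_summable m d hx.le (hxq.trans hq1) ω) ⟨hx, hxq⟩
  · unfold PiOne DD
    rw [clampQ_eq hx.le hxq.le]
    exact h
  · intro n y hy
    have := hy.1.le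
    have := hy.2.le
    rw [Real.norm_eq_abs, abs_mul, abs_of_nonneg (mul_nonneg (Nat.cast_nonneg _) (pow_nonneg hy.1.le _))]
    gcongr
    exact hM _

/-- Difference of coding maps. -/
def UU (m : ℕ) (d : Fin m → ℝ) (q x : ℝ) (p : (ℕ → Fin m) × (ℕ → Fin m)) : ℝ :=
  FF m d q x p.1 - FF m d q x p.2

/-- Derivative of the difference of coding maps. -/
def VV (m : ℕ) (d : Fin m → ℝ) (q x : ℝ) (p : (ℕ → Fin m) × (ℕ → Fin m)) : ℝ :=
  DD m d q x p.1 - DD m d q x p.2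

lemma UU_continuous (m : ℕ) (d : Fin m → ℝ) {q : ℝ} (hq0 : 0 ≤ q) (hq1 : q < 1) :
    Continuous (fun p : ℝ × ((ℕ → Fin m) × (ℕ → Fin m)) => UU m d q p.1 p.2) := by
  unfold UU
  have h := FF_continuous m d hq0 hq1
  exact (h.comp (continuous_fst.prodMk (continuous_fst.comp continuous_snd))).sub
    (h.comp (continuous_fst.prodMk (continuous_snd.comp continuous_snd)))

lemma VV_continuous (m : ℕ) (d : Fin m → ℝ) {q : ℝ} (hq0 : 0 ≤ q) (hq1 : q < 1) :
    Continuous (fun p : ℝ × ((ℕ → Fin m) × (ℕ → Fin m)) => VV m d q p.1 p.2) := by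
  unfold VV
  have h := DD_continuous m d hq0 hq1
  exact (h.comp (continuous_fst.prodMk (continuous_fst.comp continuous_snd))).sub
    (h.comp (continuous_fst.prodMk (continuous_snd.comp continuous_snd)))

lemma UU_hasDerivAt (m : ℕ) (d : Fin m → ℝ) {q x : ℝ} (hq1 : q < 1) (hx : 0 < x) (hxq : x < q)
    (p : (ℕ → Fin m) × (ℕ → Fin m)) :
    HasDerivAt (fun z => UU m d q z p) (VV m d q x p) x := by
  have h := (PiOne_hasDerivAt m d hq1 hx hxq p.1).sub (PiOne_hasDerivAt m d hq1 hx hxq p.2)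
  refine h.congr_of_eventuallyEq ?_
  filter_upwards [Ioo_mem_nhds hx hxq] with z hz
  simp [UU, FF_eq m d hz.1.le hz.2.le]

/-- Coefficients of the difference. -/
def cc (m : ℕ) (d : Fin m → ℝ) (p : (ℕ → Fin m) × (ℕ → Fin m)) (n : ℕ) : ℝ :=
  d (p.1 n) - d (p.2 n)

lemma memB_cc (m : ℕ) (d : Fin m → ℝ) (hd : StrictMono d) (p : (ℕ → Fin m) × (ℕ → Fin m))
    (hp : p.1 0 ≠ p.2 0) : memB m d (cc m d p) := by
  refine ⟨fun n => ⟨p.1 n, p.2 n, rfl⟩, fun h => hp (hd.injective ?_)⟩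
  unfold cc at h; linarith

lemma Beval_cc (m : ℕ) (d : Fin m → ℝ) {q x : ℝ} (hq1 : q < 1) (hx : 0 ≤ x) (hxq : x ≤ q)
    (p : (ℕ → Fin m) × (ℕ → Fin m)) : Beval (cc m d p) x = UU m d q x p := by
  unfold UU Beval cc
  rw [FF_eq m d hx hxq, FF_eq m d hx hxq, PiOne, PiOne,
    ← (PiOne_summable m d hx (hxq.trans_lt hq1) p.1).tsum_sub
      (PiOne_summable m d hx (hxq.trans_lt hq1) p.2)]
  simp_rw [sub_mul]

lemma doubleRoot_iff (m : ℕ) (d : Fin m → ℝ) {q x : ℝ} (hq1 : q < 1) (hx : 0 < x) (hxq : x < q)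
    (p : (ℕ → Fin m) × (ℕ → Fin m)) :
    HasDoubleRootAt (cc m d p) x ↔ UU m d q x p = 0 ∧ VV m d q x p = 0 := by
  unfold HasDoubleRootAt
  rw [Beval_cc m d hq1 hx.le hxq.le]
  have : HasDerivAt (Beval (cc m d p)) (VV m d q x p) x := by
    refine (UU_hasDerivAt m d hq1 hx hxq p).congr_of_eventuallyEq ?_
    filter_upwards [Ioo_mem_nhds hx hxq] with z hz
    exact Beval_cc m d hq1 hz.1.le hz.2.le p
  rw [this.deriv]

/-- The kernel `|x|^{-a}` with values in `[0,∞]`. -/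
def ee (a x : ℝ) : ℝ≥0∞ := (ENNReal.ofReal |x|) ^ (-a)

lemma ee_meas (a : ℝ) : Measurable (ee a) := by
  unfold ee
  exact (ENNReal.measurable_ofReal.comp (continuous_abs.measurable)).pow_const _

lemma ee_cont (a : ℝ) : Continuous (ee a) := by
  unfold ee
  exact ENNReal.continuous_rpow_const.comp (ENNReal.continuous_ofReal.comp continuous_abs)

/-- pointwise dyadic bound. -/
lemma ee_le (b : ℝ) (hb : 0 < b) (x : ℝ) :
    ee b x ≤ 1 + ∑' k : ℕ, {y : ℝ | |y| ≤ (1/2:ℝ)^k}.indicator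
      (fun _ => ENNReal.ofReal (((2:ℝ)^b)^(k+1))) x := by
  by_cases hx1 : 1 ≤ |x|
  · refine le_trans ?_ le_self_add
    unfold ee
    rw [ENNReal.rpow_neg]
    apply ENNReal.inv_le_one.2
    apply ENNReal.one_le_rpow _ hb
    simpa using hx1
  push Not at hx1
  refine le_trans ?_ le_add_self
  by_cases hx0 : x = 0
  · subst hx0
    have : ∑' k : ℕ, {y : ℝ | |y| ≤ (1/2:ℝ)^k}.indicator
      (fun _ => ENNReal.ofReal (((2:ℝ)^b)^(k+1))) 0 = ⊤ := by
      rw [eq_top_iff, ← ENNReal.tsum_const_eq_top_of_ne_zero (α := ℕ) (c := 1) one_ne_zero]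
      refine ENNReal.tsum_le_tsum fun k => ?_
      rw [indicator_of_mem]
      · rw [ENNReal.one_le_ofReal]
        exact one_le_pow₀ (Real.one_le_rpow (by norm_num) hb.le)
      · simp
    rw [this]; exact le_top
  have hpos : 0 < |x| := abs_pos.2 hx0
  obtain ⟨k, hk1, hk2⟩ := exists_nat_pow_near_of_lt_one hpos hx1.le (y := (1/2:ℝ)) (by norm_num) (by norm_num)
  refine le_trans ?_ (ENNReal.le_tsum k)
  rw [indicator_of_mem (by exact hk2)]
  unfold ee
  rw [ENNReal.ofReal_rpow_of_pos hpos]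
  apply ENNReal.ofReal_le_ofReal
  have h2 : ((2:ℝ)^b)^(k+1) = ((1/2:ℝ)^(k+1))^(-b) := by
    rw [Real.rpow_neg (by positivity), ← Real.inv_rpow (by positivity), one_div, inv_pow, inv_inv,
      ← Real.rpow_natCast, ← Real.rpow_mul (by norm_num), ← Real.rpow_natCast, ← Real.rpow_mul (by norm_num)]
    ring_nf
  rw [h2]
  exact Real.rpow_le_rpow_of_nonpos (by positivity) hk1.le (by linarith)

lemma lintegral_ee_le {α : Type*} [MeasurableSpace α] (μ : Measure α) (f : α → ℝ)
    (hf : Measurable f) {b β : ℝ} (hb : 0 < b) (C : ℝ≥0∞)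
    (hμ : μ univ ≤ C) (h : ∀ r : ℝ, 0 < r → r ≤ 1 → μ {x | |f x| ≤ r} ≤ C * ENNReal.ofReal (r ^ β)) :
    ∫⁻ x, ee b (f x) ∂μ ≤
      C * (1 + ∑' k : ℕ, ENNReal.ofReal (2^b * (2^(b-β)) ^ k)) := by
  have hms : ∀ k : ℕ, MeasurableSet {y : ℝ | |y| ≤ (1/2:ℝ)^k} := fun k =>
    (isClosed_le continuous_abs continuous_const).measurableSet
  calc ∫⁻ x, ee b (f x) ∂μ ≤ ∫⁻ x, (1 + ∑' k : ℕ, {y : ℝ | |y| ≤ (1/2:ℝ)^k}.indicator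
      (fun _ => ENNReal.ofReal (((2:ℝ)^b)^(k+1))) (f x)) ∂μ := lintegral_mono fun x => ee_le b hb _
    _ = μ univ + ∑' k : ℕ, ENNReal.ofReal (((2:ℝ)^b)^(k+1)) * μ {x | |f x| ≤ (1/2:ℝ)^k} := by
      rw [lintegral_add_left measurable_const, lintegral_tsum]
      · simp only [lintegral_const, one_mul]
        congr 1
        refine tsum_congr fun k => ?_
        have : (fun x => {y : ℝ | |y| ≤ (1/2:ℝ)^k}.indicator
          (fun _ => ENNReal.ofReal (((2:ℝ)^b)^(k+1))) (f x)) = 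
          {x | |f x| ≤ (1/2:ℝ)^k}.indicator (fun _ => ENNReal.ofReal (((2:ℝ)^b)^(k+1))) := by
          ext x; simp [indicator]
        rw [this]; exact lintegral_indicator_const (hf (hms k)) _
      · intro k
        exact ((measurable_const.indicator (hms k)).comp hf).aemeasurable
    _ ≤ C + ∑' k : ℕ, ENNReal.ofReal (((2:ℝ)^b)^(k+1)) * (C * ENNReal.ofReal (((1/2:ℝ)^k) ^ β)) := by
      gcongr with k
      exact h _ (by positivity) (pow_le_one₀ (by norm_num) (by norm_num))
    _ = C * (1 + ∑' k : ℕ, ENNReal.ofReal (2^b * (2^(b-β)) ^ k)) := by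
      rw [mul_add, mul_one, ← ENNReal.tsum_mul_left]
      congr 1
      refine tsum_congr fun k => ?_
      rw [mul_left_comm, ← ENNReal.ofReal_mul (by positivity)]
      congr 2
      rw [one_div, inv_pow, Real.inv_rpow (by positivity), ← Real.rpow_neg (by positivity),
        Real.rpow_sub (by norm_num), div_pow, pow_succ]
      have : ((2:ℝ)^k)^(-β) = (((2:ℝ)^β)^k)⁻¹ := by
        rw [Real.rpow_neg (by positivity), ← Real.rpow_natCast, ← Real.rpow_natCast,
          ← Real.rpow_mul (by norm_num), ← Real.rpow_mul (by norm_num), mul_comm]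
      rw [this]
      field_simp

lemma const_ne_top {b β : ℝ} (hbβ : b < β) :
    (1 + ∑' k : ℕ, ENNReal.ofReal (2^b * (2^(b-β)) ^ k)) ≠ ⊤ := by
  refine ENNReal.add_ne_top.2 ⟨ENNReal.one_ne_top, ?_⟩
  have hs : Summable (fun k : ℕ => (2:ℝ)^b * ((2:ℝ)^(b-β)) ^ k) := by
    apply Summable.mul_left
    apply summable_geometric_of_lt_one (by positivity)
    exact Real.rpow_lt_one_of_one_lt_of_neg (by norm_num) (by linarith)
  rw [← ENNReal.ofReal_tsum_of_nonneg (fun k => by positivity) hs]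
  exact ENNReal.ofReal_ne_top

lemma equicont {X : Type*} [TopologicalSpace X] [CompactSpace X] (f : ℝ → X → ℝ)
    (hf : Continuous (fun p : ℝ × X => f p.1 p.2)) (x0 : ℝ) {ε : ℝ} (hε : 0 < ε) :
    ∀ᶠ x in 𝓝 x0, ∀ p, dist (f x0 p) (f x p) < ε := by
  have := (isCompact_univ (X := X)).eventually_forall_of_forall_eventually (x₀ := x0)
    (P := fun x p => dist (f x0 p) (f x p) < ε) (fun p _ => ?_)
  · simpa using this
  · have h1 : Continuous (fun z : ℝ × X => dist (f x0 z.2) (f z.1 z.2)) :=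
      (hf.comp (continuous_const.prodMk continuous_snd)).dist hf
    have := h1.tendsto (x0, p)
    simp only [dist_self] at this
    exact this.eventually (gt_mem_nhds hε)

/-- local transversality: if the pair is quantitatively transversal at `x0`, integral is bounded. -/
lemma transversal (m : ℕ) (d : Fin m → ℝ) {q x0 : ℝ} (hq1 : q < 1) (hx : 0 < x0) (hxq : x0 < q)
    {δ a : ℝ} (hδ : 0 < δ) (ha : 0 < a) (ha1 : a < 1) :
    ∃ η > 0, ∃ C : ℝ≥0∞, C ≠ ⊤ ∧ Ioo (x0 - η) (x0 + η) ⊆ Ioo 0 q ∧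
      ∀ p : (ℕ → Fin m) × (ℕ → Fin m), (δ ≤ |UU m d q x0 p| ∨ δ ≤ |VV m d q x0 p|) →
        ∫⁻ x in Ioo (x0 - η) (x0 + η), ee a (UU m d q x p) ≤ C := by
  have hq0 : 0 ≤ q := by linarith
  have h1 := equicont (UU m d q) (UU_continuous m d hq0 hq1) x0 (half_pos hδ)
  have h2 := equicont (VV m d q) (VV_continuous m d hq0 hq1) x0 (half_pos hδ)
  obtain ⟨η, hη, hball⟩ := Metric.eventually_nhds_iff_ball.1
    (h1.and (h2.and (Ioo_mem_nhds hx hxq)))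
  rw [Real.ball_eq_Ioo] at hball
  set N := Ioo (x0 - η) (x0 + η) with hN
  set C0 : ℝ≥0∞ := volume N + ENNReal.ofReal (4/δ) + volume N * ENNReal.ofReal (2/δ) with hC0
  have hvN : volume N ≠ ⊤ := by simp [hN]
  refine ⟨η, hη, C0 * (1 + ∑' k : ℕ, ENNReal.ofReal (2^a * (2^(a-1)) ^ k)), ?_, ?_, ?_⟩
  · refine ENNReal.mul_ne_top ?_ (const_ne_top ha1)
    exact ENNReal.add_ne_top.2 ⟨ENNReal.add_ne_top.2 ⟨hvN, ENNReal.ofReal_ne_top⟩,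
      ENNReal.mul_ne_top hvN ENNReal.ofReal_ne_top⟩
  · intro x hx; exact (hball x hx).2.2
  · intro p hp
    have hcont : Continuous (fun x => UU m d q x p) :=
      (UU_continuous m d hq0 hq1).comp (Continuous.prodMk_left p)
    refine lintegral_ee_le _ _ hcont.measurable ha C0 ?_ ?_
    · rw [Measure.restrict_apply_univ, hC0, add_assoc]
      exact le_self_add
    intro r hr hr1
    rw [Real.rpow_one, Measure.restrict_apply (isClosed_le hcont.abs continuous_const).measurableSet]
    rcases hp with hp | hp
    · by_cases hrδ : r < δ/2
      · have : {x | |UU m d q x p| ≤ r} ∩ N = ∅ := by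
          ext x
          simp only [mem_inter_iff, mem_ofPred_eq, mem_empty_iff_false, iff_false, not_and]
          intro hxr hxN
          have := (hball x hxN).1 p
          rw [Real.dist_eq] at this
          have h3 := abs_sub_abs_le_abs_sub (UU m d q x0 p) (UU m d q x p)
          linarith
        rw [this]; simp
      · push Not at hrδ
        calc volume ({x | |UU m d q x p| ≤ r} ∩ N) ≤ volume N := measure_mono inter_subset_right
          _ = volume N * 1 := (mul_one _).symm
          _ ≤ volume N * (ENNReal.ofReal (2/δ) * ENNReal.ofReal r) := by
            gcongr
            rw [← ENNReal.ofReal_mul (by positivity), ENNReal.one_le_ofReal]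
            rw [div_mul_eq_mul_div, le_div_iff₀ hδ]; linarith
          _ ≤ C0 * ENNReal.ofReal r := by
            rw [← mul_assoc]; gcongr; exact le_add_self
    · refine (Real.volume_le_diam _).trans ?_
      calc Metric.ediam ({x | |UU m d q x p| ≤ r} ∩ N) ≤ ENNReal.ofReal (4/δ * r) := by
            refine Metric.ediam_le fun x hx y hy => ?_
            rw [edist_dist]
            apply ENNReal.ofReal_le_ofReal
            wlog hxy : x < y generalizing x y
            · rcases (not_lt.1 hxy).eq_or_lt with h | h
              · rw [h, dist_self]; positivity
              · rw [dist_comm]; exact this y hy x hx h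
            have hsub : Icc x y ⊆ N := (ordConnected_Ioo).out hx.2 hy.2
            obtain ⟨z, hz, hzeq⟩ := exists_hasDerivAt_eq_slope (fun x => UU m d q x p)
              (fun x => VV m d q x p) hxy hcont.continuousOn (fun z hz => by
                have := (hball z (hsub (Ioo_subset_Icc_self hz))).2.2
                exact UU_hasDerivAt m d hq1 this.1 this.2 p)
            have hV := (hball z (hsub (Ioo_subset_Icc_self hz))).2.1 p
            rw [Real.dist_eq] at hV
            have h3 := abs_sub_abs_le_abs_sub (VV m d q x0 p) (VV m d q z p)
            have h4 : δ/2 ≤ |VV m d q z p| := by linarith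
            have hyx : 0 < y - x := by linarith
            rw [eq_div_iff hyx.ne'] at hzeq
            have h5 : |VV m d q z p| * (y - x) ≤ 2 * r := by
              rw [← abs_of_pos hyx, ← abs_mul, hzeq]
              have ha := hx.1
              have hb := hy.1
              simp only [mem_ofPred_eq] at ha hb
              have := abs_sub (UU m d q y p) (UU m d q x p)
              linarith
            rw [Real.dist_eq, abs_sub_comm, abs_of_pos hyx, div_mul_eq_mul_div, le_div_iff₀ hδ]
            nlinarith
        _ = ENNReal.ofReal (4/δ) * ENNReal.ofReal r := ENNReal.ofReal_mul (by positivity)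
        _ ≤ C0 * ENNReal.ofReal r := by
          gcongr
          rw [hC0, add_right_comm]
          exact le_add_self

lemma corr_energy (m : ℕ) (d : Fin m → ℝ) (ρ : Measure (ℕ → Fin m)) [IsProbabilityMeasure ρ]
    {l : ℝ} (hl0 : 0 < l) (hl1 : l < 1) (h : lowerCorrDim (ρ.map (PiOne m d l)) = 1)
    {b : ℝ} (hb0 : 0 < b) (hb1 : b < 1) :
    ∫⁻ p, ee b (PiOne m d l p.1 - PiOne m d l p.2) ∂(ρ.prod ρ) ≠ ⊤ := by
  have hmeas : Measurable (PiOne m d l) := (PiOne_continuous m d hl0.le hl1).measurable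
  have hfm : Measurable (fun p : (ℕ → Fin m) × (ℕ → Fin m) => PiOne m d l p.1 - PiOne m d l p.2) :=
    (hmeas.comp measurable_fst).sub (hmeas.comp measurable_snd)
  set P : ℝ → ℝ≥0∞ := fun r => (ρ.prod ρ) {p | |PiOne m d l p.1 - PiOne m d l p.2| ≤ r} with hP
  have hPeq : ∀ r, ((ρ.map (PiOne m d l)).prod (ρ.map (PiOne m d l)))
      {p : ℝ × ℝ | |p.1 - p.2| ≤ r} = P r := by
    intro r
    rw [Measure.map_prod_map _ _ hmeas hmeas, Measure.map_apply (hmeas.prodMap hmeas)]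
    · rfl
    · exact (isClosed_le (by fun_prop) continuous_const).measurableSet
  unfold lowerCorrDim at h
  simp_rw [hPeq] at h
  rw [liminf_eq] at h
  set A : Set ℝ := {a | ∀ᶠ r in 𝓝[>] (0:ℝ), a ≤ Real.log (P r).toReal / Real.log r} with hA
  have hne : A.Nonempty := by
    by_contra hcon
    rw [not_nonempty_iff_eq_empty] at hcon
    rw [hcon, Real.sSup_empty] at h
    norm_num at h
  obtain ⟨β, hβA, hβ⟩ := exists_lt_of_lt_csSup hne (show b < sSup A by rw [h]; exact hb1)
  have hβ0 : 0 < β := hb0.trans hβ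
  have hev : ∀ᶠ r in 𝓝[>] (0:ℝ), β ≤ Real.log (P r).toReal / Real.log r := hβA
  obtain ⟨r0, hr0, hr⟩ := (mem_nhdsGT_iff_exists_Ioo_subset).1 hev
  have hr0 : (0:ℝ) < r0 := hr0
  set r1 := min r0 1 with hr1
  have hr1p : 0 < r1 := lt_min hr0 one_pos
  have hPle1 : ∀ r, P r ≤ 1 := fun r => prob_le_one
  have hsmall : ∀ r, 0 < r → r < r1 → P r ≤ ENNReal.ofReal (r ^ β) := by
    intro r hrp hrlt
    have h1 : β ≤ Real.log (P r).toReal / Real.log r := hr ⟨hrp, hrlt.trans_le (min_le_left _ _)⟩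
    have hlog : Real.log r < 0 := Real.log_neg hrp (hrlt.trans_le (min_le_right _ _))
    rw [le_div_iff_of_neg hlog] at h1
    rw [← ENNReal.ofReal_toReal (ne_top_of_le_ne_top ENNReal.one_ne_top (hPle1 r))]
    apply ENNReal.ofReal_le_ofReal
    rcases (ENNReal.toReal_nonneg (a := P r)).eq_or_lt with h0 | h0
    · rw [← h0]; positivity
    · rw [← Real.log_le_log_iff h0 (by positivity), Real.log_rpow hrp]
      exact h1
  set C : ℝ≥0∞ := 1 + ENNReal.ofReal (r1 ^ (-β)) with hC
  have hmain := lintegral_ee_le (ρ.prod ρ) _ hfm hb0 (β := β) C ?_ ?_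
  · refine ne_top_of_le_ne_top ?_ hmain
    exact ENNReal.mul_ne_top (ENNReal.add_ne_top.2 ⟨ENNReal.one_ne_top, ENNReal.ofReal_ne_top⟩)
      (const_ne_top hβ)
  · rw [measure_univ]; exact le_self_add
  · intro r hrp hrle
    change P r ≤ _
    by_cases hrr : r < r1
    · refine (hsmall r hrp hrr).trans ?_
      rw [hC, add_mul, one_mul]; exact le_self_add
    · push Not at hrr
      refine (hPle1 r).trans ?_
      rw [hC, add_mul]
      refine le_trans ?_ le_add_self
      rw [← ENNReal.ofReal_mul (by positivity), ENNReal.one_le_ofReal, Real.rpow_neg hr1p.le,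
        inv_mul_eq_div, le_div_iff₀ (by positivity), one_mul]
      exact Real.rpow_le_rpow hr1p.le hrr hβ0.le

/-- Prepend a digit. -/
def consW {m : ℕ} (i : Fin m) (ω : ℕ → Fin m) : ℕ → Fin m
  | 0 => i
  | n + 1 => ω n

/-- Left shift. -/
def shiftW {m : ℕ} (ω : ℕ → Fin m) : ℕ → Fin m := fun n => ω (n + 1)

lemma shift_cons {m : ℕ} (i : Fin m) (ω : ℕ → Fin m) : shiftW (consW i ω) = ω := rfl

lemma consW_meas {m : ℕ} (i : Fin m) : Measurable (consW i) := by
  rw [measurable_pi_iff]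
  intro n
  cases n with
  | zero => exact measurable_const
  | succ n => exact measurable_pi_apply n

lemma shiftW_meas {m : ℕ} : Measurable (shiftW (m := m)) := by
  rw [measurable_pi_iff]
  intro n
  exact measurable_pi_apply (n+1)

lemma ext_cyl {m : ℕ} (ρ ρ' : Measure (ℕ → Fin m)) [IsFiniteMeasure ρ']
    (h : ∀ (n : ℕ) (w : Fin n → Fin m), ρ {ω | ∀ i : Fin n, ω i.1 = w i} =
      ρ' {ω | ∀ i : Fin n, ω i.1 = w i}) : ρ = ρ' := by
  have key : ∀ n : ℕ, ρ.map (fun ω (i : Fin n) => ω i.1) = ρ'.map (fun ω (i : Fin n) => ω i.1) := by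
    intro n
    have hm : Measurable (fun (ω : ℕ → Fin m) (i : Fin n) => ω i.1) :=
      measurable_pi_lambda _ fun i => measurable_pi_apply _
    rw [Measure.ext_iff_singleton]
    intro w
    rw [Measure.map_apply hm (measurableSet_singleton w), Measure.map_apply hm (measurableSet_singleton w)]
    have : (fun (ω : ℕ → Fin m) (i : Fin n) => ω i.1) ⁻¹' {w} = {ω | ∀ i : Fin n, ω i.1 = w i} := by
      ext ω
      simp [funext_iff]
    rw [this, h]
  refine IsProjectiveLimit.unique (P := fun J => ρ'.map J.restrict) ?_ (fun J => rfl)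
  intro J
  obtain ⟨n, hn⟩ := J.exists_nat_subset_range
  have hm : Measurable (fun (ω : ℕ → Fin m) (i : Fin n) => ω i.1) :=
    measurable_pi_lambda _ fun i => measurable_pi_apply _
  have hg : Measurable (fun (v : Fin n → Fin m) (j : J) => v ⟨j.1, Finset.mem_range.1 (hn j.2)⟩) :=
    measurable_pi_lambda _ fun i => measurable_pi_apply _
  have hcomp : (J.restrict : (ℕ → Fin m) → (J → Fin m)) =
      (fun (v : Fin n → Fin m) (j : J) => v ⟨j.1, Finset.mem_range.1 (hn j.2)⟩) ∘
      (fun (ω : ℕ → Fin m) (i : Fin n) => ω i.1) := rfl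
  change ρ.map J.restrict = ρ'.map J.restrict
  rw [hcomp, ← Measure.map_map hg hm, ← Measure.map_map hg hm, key]

lemma selfsim {m : ℕ} (hm : 2 ≤ m) (ρ : Measure (ℕ → Fin m))
    (hρ : IsBernoulliWith (fun _ => (m : ℝ≥0∞)⁻¹) ρ) :
    ρ = ∑ i : Fin m, (m : ℝ≥0∞)⁻¹ • ρ.map (consW i) := by
  have hprob := hρ.1
  have hm0 : (m : ℝ≥0∞) ≠ 0 := by simp; omega
  have hinv : (m : ℝ≥0∞)⁻¹ ≠ ⊤ := by simp; omega
  have huniv : (∑ i : Fin m, (m : ℝ≥0∞)⁻¹ • ρ.map (consW i)) univ = 1 := by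
    rw [Measure.finsetSum_apply]
    simp only [Measure.smul_apply, Measure.map_apply (consW_meas _) MeasurableSet.univ, preimage_univ,
      measure_univ, smul_eq_mul, mul_one, Finset.sum_const, Finset.card_univ, Fintype.card_fin, nsmul_eq_mul]
    exact ENNReal.mul_inv_cancel hm0 (ENNReal.natCast_ne_top m)
  have : IsFiniteMeasure (∑ i : Fin m, (m : ℝ≥0∞)⁻¹ • ρ.map (consW i)) := ⟨by rw [huniv]; simp⟩
  refine ext_cyl _ _ fun n w => ?_
  have hms : MeasurableSet {ω : ℕ → Fin m | ∀ i : Fin n, ω i.1 = w i} := by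
    have : {ω : ℕ → Fin m | ∀ i : Fin n, ω i.1 = w i} = ⋂ i : Fin n, {ω | ω i.1 = w i} := by
      ext; simp
    rw [this]
    exact MeasurableSet.iInter fun i => 
      measurableSet_eq_fun (measurable_pi_apply i.1) measurable_const
  cases n with
  | zero => 
    have : {ω : ℕ → Fin m | ∀ i : Fin 0, ω i.1 = w i} = univ := by
      ext; simp
    rw [this, huniv, measure_univ]
  | succ n =>
    rw [hρ.2, Measure.finsetSum_apply]
    simp only [Measure.smul_apply, Measure.map_apply (consW_meas _) hms, smul_eq_mul]
    rw [Finset.sum_eq_single (w 0)]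
    · have : consW (w 0) ⁻¹' {ω : ℕ → Fin m | ∀ i : Fin (n+1), ω i.1 = w i} =
        {ω : ℕ → Fin m | ∀ i : Fin n, ω i.1 = w i.succ} := by
        ext ω
        simp only [mem_preimage, mem_ofPred_eq, Fin.forall_fin_succ]
        exact ⟨fun h => h.2, fun h => ⟨rfl, h⟩⟩
      rw [this, hρ.2]
      simp [pow_succ, mul_comm]
    · intro i _ hi
      have : consW i ⁻¹' {ω : ℕ → Fin m | ∀ i : Fin (n+1), ω i.1 = w i} = ∅ := by
        ext ω
        simp only [mem_preimage, mem_ofPred_eq, mem_empty_iff_false, iff_false]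
        exact fun h => hi (h 0)
      rw [this]; simp
    · simp

lemma lintegral_selfsim {m : ℕ} (hm : 2 ≤ m) (ρ : Measure (ℕ → Fin m))
    (hρ : IsBernoulliWith (fun _ => (m : ℝ≥0∞)⁻¹) ρ) (g : (ℕ → Fin m) → ℝ≥0∞) (hg : Measurable g) :
    ∫⁻ ω, g ω ∂ρ = ∑ i, (m : ℝ≥0∞)⁻¹ * ∫⁻ ω, g (consW i ω) ∂ρ := by
  conv_lhs => rw [selfsim hm ρ hρ]
  rw [lintegral_finsetSum_measure]
  refine Finset.sum_congr rfl fun i _ => ?_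
  rw [lintegral_smul_measure, lintegral_map hg (consW_meas i)]
  rfl

/-- Pairs agreeing at the first digit. -/
def agree0 (m : ℕ) : Set ((ℕ → Fin m) × (ℕ → Fin m)) := {p | p.1 0 = p.2 0}

lemma agree0_meas (m : ℕ) : MeasurableSet (agree0 m) := by
  unfold agree0
  exact measurableSet_eq_fun ((measurable_pi_apply 0).comp measurable_fst)
    ((measurable_pi_apply 0).comp measurable_snd)

lemma pair_selfsim {m : ℕ} (hm : 2 ≤ m) (ρ : Measure (ℕ → Fin m))
    (hρ : IsBernoulliWith (fun _ => (m : ℝ≥0∞)⁻¹) ρ)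
    (F : (ℕ → Fin m) × (ℕ → Fin m) → ℝ≥0∞) (hF : Measurable F) :
    ∫⁻ p in agree0 m, F (shiftW p.1, shiftW p.2) ∂(ρ.prod ρ) =
      (m : ℝ≥0∞)⁻¹ * ∫⁻ p, F p ∂(ρ.prod ρ) := by
  have hprob := hρ.1
  have hm0 : (m : ℝ≥0∞) ≠ 0 := by simp; omega
  have hG : Measurable (fun p : (ℕ → Fin m) × (ℕ → Fin m) => (agree0 m).indicator
      (fun p => F (shiftW p.1, shiftW p.2)) p) :=
    (hF.comp ((shiftW_meas.comp measurable_fst).prodMk (shiftW_meas.comp measurable_snd))).indicator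
      (agree0_meas m)
  rw [← lintegral_indicator (agree0_meas m), lintegral_prod _ hG.aemeasurable,
    lintegral_selfsim hm ρ hρ _ hG.lintegral_prod_right', lintegral_prod _ hF.aemeasurable]
  have hterm : ∀ i : Fin m, ∀ ω : ℕ → Fin m, 
      ∫⁻ τ, (agree0 m).indicator (fun p => F (shiftW p.1, shiftW p.2)) (consW i ω, τ) ∂ρ =
      (m : ℝ≥0∞)⁻¹ * ∫⁻ τ, F (ω, τ) ∂ρ := by
    intro i ω
    rw [lintegral_selfsim hm ρ hρ (fun τ => (agree0 m).indicator
      (fun p => F (shiftW p.1, shiftW p.2)) (consW i ω, τ)) (hG.comp measurable_prodMk_left), Finset.sum_eq_single i]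
    · congr 1
      refine lintegral_congr fun τ => ?_
      rw [indicator_of_mem (show (consW i ω, consW i τ) ∈ agree0 m from rfl)]
      rfl
    · intro j _ hj
      have : ∀ τ, (agree0 m).indicator (fun p => F (shiftW p.1, shiftW p.2)) (consW i ω, consW j τ) = 0 := by
        intro τ
        apply indicator_of_notMem
        exact fun h => hj (Eq.symm h)
      simp [this]
    · simp
  simp_rw [hterm]
  rw [lintegral_const_mul _ hF.lintegral_prod_right', Finset.sum_const, Finset.card_univ,
    Fintype.card_fin, nsmul_eq_mul, ← mul_assoc, ENNReal.mul_inv_cancel hm0 (ENNReal.natCast_ne_top m), one_mul]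

/-- The two-parameter energy kernel. -/
def HH (m : ℕ) (d : Fin m → ℝ) (a b g l : ℝ) (p : (ℕ → Fin m) × (ℕ → Fin m)) : ℝ≥0∞ :=
  ee a (PiOne m d g p.1 - PiOne m d g p.2) * ee b (PiOne m d l p.1 - PiOne m d l p.2)

lemma diff_meas (m : ℕ) (d : Fin m → ℝ) {g : ℝ} (hg : 0 < g) (hg1 : g < 1) :
    Measurable (fun p : (ℕ → Fin m) × (ℕ → Fin m) => PiOne m d g p.1 - PiOne m d g p.2) :=
  ((PiOne_continuous m d hg.le hg1).measurable.comp measurable_fst).sub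
    ((PiOne_continuous m d hg.le hg1).measurable.comp measurable_snd)

lemma HH_meas (m : ℕ) (d : Fin m → ℝ) (a b : ℝ) {g l : ℝ} (hg : 0 < g) (hg1 : g < 1)
    (hl : 0 < l) (hl1 : l < 1) : Measurable (HH m d a b g l) :=
  ((ee_meas a).comp (diff_meas m d hg hg1)).mul ((ee_meas b).comp (diff_meas m d hl hl1))

lemma PiOne_shift (m : ℕ) (d : Fin m → ℝ) {g : ℝ} (hg : 0 < g) (hg1 : g < 1) (ω : ℕ → Fin m) :
    PiOne m d g ω = d (ω 0) + g * PiOne m d g (shiftW ω) := by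
  unfold PiOne
  rw [(PiOne_summable m d hg.le hg1 ω).tsum_eq_zero_add, ← tsum_mul_left]
  simp only [pow_zero, mul_one, shiftW]
  congr 1
  refine tsum_congr fun n => ?_
  ring

lemma ee_mul (a g x : ℝ) : ee a (g * x) = ee a g * ee a x := by
  unfold ee
  rw [abs_mul, ENNReal.ofReal_mul (abs_nonneg _)]
  rw [ENNReal.mul_rpow_of_ne_top ENNReal.ofReal_ne_top ENNReal.ofReal_ne_top]

/-- Pairs whose first disagreement is at place `n`. -/
def XX (m : ℕ) : ℕ → Set ((ℕ → Fin m) × (ℕ → Fin m))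
  | 0 => (agree0 m)ᶜ
  | n + 1 => agree0 m ∩ {p | (shiftW p.1, shiftW p.2) ∈ XX m n}

lemma shift2_meas (m : ℕ) :
    Measurable (fun p : (ℕ → Fin m) × (ℕ → Fin m) => (shiftW p.1, shiftW p.2)) :=
  (shiftW_meas.comp measurable_fst).prodMk (shiftW_meas.comp measurable_snd)

lemma XX_meas (m n : ℕ) : MeasurableSet (XX m n) := by
  induction n with
  | zero => exact (agree0_meas m).compl
  | succ n ih => exact (agree0_meas m).inter (shift2_meas m ih)

lemma HH_shift (m : ℕ) (d : Fin m → ℝ) (a b : ℝ) {g l : ℝ} (hg : 0 < g) (hg1 : g < 1)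
    (hl : 0 < l) (hl1 : l < 1) (p : (ℕ → Fin m) × (ℕ → Fin m)) (hp : p ∈ agree0 m) :
    HH m d a b g l p = (ee a g * ee b l) * HH m d a b g l (shiftW p.1, shiftW p.2) := by
  have hp' : p.1 0 = p.2 0 := hp
  have key : ∀ {x : ℝ}, 0 < x → x < 1 → PiOne m d x p.1 - PiOne m d x p.2 =
      x * (PiOne m d x (shiftW p.1) - PiOne m d x (shiftW p.2)) := by
    intro x hx hx1
    rw [PiOne_shift m d hx hx1 p.1, PiOne_shift m d hx hx1 p.2, hp']; ring
  unfold HH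
  rw [key hg hg1, key hl hl1, ee_mul, ee_mul]
  ring

lemma lintegral_XX_succ {m : ℕ} (hm : 2 ≤ m) (ρ : Measure (ℕ → Fin m))
    (hρ : IsBernoulliWith (fun _ => (m : ℝ≥0∞)⁻¹) ρ) (d : Fin m → ℝ) (a b : ℝ) {g l : ℝ}
    (hg : 0 < g) (hg1 : g < 1) (hl : 0 < l) (hl1 : l < 1) (n : ℕ) :
    ∫⁻ p in XX m (n+1), HH m d a b g l p ∂(ρ.prod ρ) =
      ((m : ℝ≥0∞)⁻¹ * (ee a g * ee b l)) * ∫⁻ p in XX m n, HH m d a b g l p ∂(ρ.prod ρ) := by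
  have hH := HH_meas m d a b hg hg1 hl hl1
  have hI : Measurable ((XX m n).indicator (HH m d a b g l)) := hH.indicator (XX_meas m n)
  have h := pair_selfsim hm ρ hρ (fun p => (ee a g * ee b l) * (XX m n).indicator (HH m d a b g l) p)
    (hI.const_mul _)
  rw [lintegral_const_mul _ hI, lintegral_indicator (XX_meas m n), ← lintegral_indicator (agree0_meas m)] at h
  rw [mul_assoc, ← h, ← lintegral_indicator (XX_meas m (n+1))]
  refine lintegral_congr fun p => ?_
  by_cases hp : p ∈ agree0 m
  · rw [indicator_of_mem hp]
    by_cases hq : (shiftW p.1, shiftW p.2) ∈ XX m n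
    · rw [indicator_of_mem (show p ∈ XX m (n+1) from ⟨hp, hq⟩), indicator_of_mem hq]
      exact HH_shift m d a b hg hg1 hl hl1 p hp
    · rw [indicator_of_notMem (show p ∉ XX m (n+1) from fun h => hq h.2), indicator_of_notMem hq,
        mul_zero]
  · rw [indicator_of_notMem hp, indicator_of_notMem (show p ∉ XX m (n+1) from fun h => hp h.1)]

lemma diag_null {m : ℕ} (hm : 2 ≤ m) (ρ : Measure (ℕ → Fin m))
    (hρ : IsBernoulliWith (fun _ => (m : ℝ≥0∞)⁻¹) ρ) : (ρ.prod ρ) (diagonal (ℕ → Fin m)) = 0 := by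
  have hprob := hρ.1
  have hD : MeasurableSet (diagonal (ℕ → Fin m)) := isClosed_diagonal.measurableSet
  have h := pair_selfsim hm ρ hρ ((diagonal (ℕ → Fin m)).indicator 1) (measurable_one.indicator hD)
  rw [lintegral_indicator_one hD] at h
  have h2 : (ρ.prod ρ) (diagonal (ℕ → Fin m)) ≤ (m : ℝ≥0∞)⁻¹ * (ρ.prod ρ) (diagonal (ℕ → Fin m)) := by
    rw [← h, ← lintegral_indicator (agree0_meas m), ← lintegral_indicator_one hD]
    refine lintegral_mono fun p => ?_
    by_cases hp : p ∈ diagonal (ℕ → Fin m)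
    · have hp' : p.1 = p.2 := hp
      rw [indicator_of_mem (show p ∈ agree0 m from congrFun hp' 0),
        indicator_of_mem (show (shiftW p.1, shiftW p.2) ∈ diagonal (ℕ → Fin m) from congrArg shiftW hp')]
      exact indicator_le_self' (fun _ _ => zero_le) _
    · rw [indicator_of_notMem hp]; exact zero_le
  by_contra hne
  have hlt : (m : ℝ≥0∞)⁻¹ * (ρ.prod ρ) (diagonal (ℕ → Fin m)) < 1 * (ρ.prod ρ) (diagonal (ℕ → Fin m)) := by
    rw [ENNReal.mul_lt_mul_iff_left hne (measure_ne_top _ _), ENNReal.inv_lt_one]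
    exact_mod_cast (show 1 < m by omega)
  rw [one_mul] at hlt
  exact absurd h2 (not_le.2 hlt)

lemma cover_XX (m : ℕ) : (univ : Set ((ℕ → Fin m) × (ℕ → Fin m))) ⊆
    diagonal (ℕ → Fin m) ∪ ⋃ n, XX m n := by
  intro p _
  by_cases hp : p.1 = p.2
  · exact Or.inl hp
  right
  have hex : ∃ n, p.1 n ≠ p.2 n := by
    by_contra hcon
    push Not at hcon
    exact hp (funext hcon)
  obtain ⟨n, hn⟩ := hex
  clear hp
  induction n generalizing p with
  | zero => exact mem_iUnion.2 ⟨0, hn⟩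
  | succ n ih =>
    by_cases h0 : p ∈ agree0 m
    · obtain ⟨k, hk⟩ := mem_iUnion.1 (ih (p := (shiftW p.1, shiftW p.2)) (mem_univ _) hn)
      exact mem_iUnion.2 ⟨k+1, h0, hk⟩
    · exact mem_iUnion.2 ⟨0, h0⟩

lemma energy_finite {m : ℕ} (hm : 2 ≤ m) (ρ : Measure (ℕ → Fin m))
    (hρ : IsBernoulliWith (fun _ => (m : ℝ≥0∞)⁻¹) ρ) (d : Fin m → ℝ) (a b : ℝ) {g l : ℝ}
    (hg : 0 < g) (hg1 : g < 1) (hl : 0 < l) (hl1 : l < 1)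
    (h0 : ∫⁻ p in (agree0 m)ᶜ, HH m d a b g l p ∂(ρ.prod ρ) ≠ ⊤)
    (h1 : 1 < m * (g ^ a * l ^ b)) :
    ∫⁻ p, HH m d a b g l p ∂(ρ.prod ρ) ≠ ⊤ := by
  set κ := (m : ℝ≥0∞)⁻¹ * (ee a g * ee b l) with hκ
  have hmpos : (0:ℝ) < m := by exact_mod_cast (show 0 < m by omega)
  have hκ1 : κ < 1 := by
    have e1 : κ = ENNReal.ofReal ((m * (g ^ a * l ^ b))⁻¹) := by
      rw [hκ, ee, ee, abs_of_pos hg, abs_of_pos hl, ENNReal.ofReal_rpow_of_pos hg,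
        ENNReal.ofReal_rpow_of_pos hl, ← ENNReal.ofReal_mul (by positivity), ← ENNReal.ofReal_natCast,
        ← ENNReal.ofReal_inv_of_pos hmpos, ← ENNReal.ofReal_mul (by positivity),
        Real.rpow_neg hg.le, Real.rpow_neg hl.le, mul_inv, mul_inv]
    rw [e1, ENNReal.ofReal_lt_one]
    exact inv_lt_one_of_one_lt₀ h1
  have hn : ∀ n, ∫⁻ p in XX m n, HH m d a b g l p ∂(ρ.prod ρ) =
      κ ^ n * ∫⁻ p in (agree0 m)ᶜ, HH m d a b g l p ∂(ρ.prod ρ) := by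
    intro n
    induction n with
    | zero => simp [XX]
    | succ n ih => rw [lintegral_XX_succ hm ρ hρ d a b hg hg1 hl hl1, ih, pow_succ]; ring
  rw [← setLIntegral_univ]
  refine ne_top_of_le_ne_top ?_ ((lintegral_mono_set (cover_XX m)).trans (lintegral_union_le _ _ _))
  rw [setLIntegral_measure_zero _ _ (diag_null hm ρ hρ), zero_add]
  refine ne_top_of_le_ne_top ?_ (lintegral_iUnion_le _ _)
  simp_rw [hn]
  rw [ENNReal.tsum_mul_right, ENNReal.tsum_geometric]
  refine ENNReal.mul_ne_top ?_ h0
  rw [ENNReal.inv_ne_top]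
  exact (tsub_pos_of_lt hκ1).ne'

lemma dim_lower {m : ℕ} (ρ : Measure (ℕ → Fin m)) [IsProbabilityMeasure ρ]
    (d : Fin m → ℝ) {a b : ℝ} (ha : 0 < a) (hb : 0 < b) {g l : ℝ}
    (hg : 0 < g) (hg1 : g < 1) (hl : 0 < l) (hl1 : l < 1)
    (h : ∫⁻ p, HH m d a b g l p ∂(ρ.prod ρ) ≠ ⊤) :
    ENNReal.ofReal (a + b) ≤ dimH (Kaff m d g l) := by
  have hH := HH_meas m d a b hg hg1 hl hl1
  rw [lintegral_prod _ hH.aemeasurable] at h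
  set φ : (ℕ → Fin m) → ℝ≥0∞ := fun ω => ∫⁻ τ, HH m d a b g l (ω, τ) ∂ρ with hφ
  have hφm : Measurable φ := hH.lintegral_prod_right'
  set M := (∫⁻ ω, φ ω ∂ρ) + 1 with hM
  have hMt : M ≠ ⊤ := ENNReal.add_ne_top.2 ⟨h, ENNReal.one_ne_top⟩
  have hM0 : M ≠ 0 := by simp [hM]
  set A : Set (ℕ → Fin m) := {ω | φ ω ≤ M} with hA
  have hApos : 0 < ρ A := by
    refine (measure_le_lintegral_pos hφm.aemeasurable).trans_le (measure_mono ?_)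
    intro ω hω
    have hω' : φ ω ≤ ∫⁻ a, φ a ∂ρ := hω
    exact le_trans hω' le_self_add
  set Pi : (ℕ → Fin m) → ℝ × ℝ := fun ω => (PiOne m d g ω, PiOne m d l ω) with hPi
  have hPim : Measurable Pi := (PiOne_continuous m d hg.le hg1).measurable.prodMk
    (PiOne_continuous m d hl.le hl1).measurable
  have hs : 0 < a + b := by linarith
  have hle : (M⁻¹ • (ρ.restrict A).map Pi) ≤ μH[a+b] := by
    refine Measure.le_hausdorffMeasure _ _ 1 one_pos fun s hs1 => ?_
    rw [← Metric.ediam_closure s] at hs1 ⊢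
    refine (measure_mono subset_closure).trans ?_
    set t := closure s with ht
    have htm : MeasurableSet t := isClosed_closure.measurableSet
    rw [Measure.smul_apply, Measure.map_apply hPim htm, Measure.restrict_apply (hPim htm), smul_eq_mul]
    by_cases hemp : (Pi ⁻¹' t ∩ A).Nonempty
    swap
    · rw [not_nonempty_iff_eq_empty.1 hemp]; simp
    obtain ⟨ω, hωt, hωA⟩ := hemp
    have hlow : ∀ τ ∈ Pi ⁻¹' t, (Metric.ediam t) ^ (-(a+b)) ≤ HH m d a b g l (ω, τ) := by
      intro τ hτ
      have hed := Metric.edist_le_ediam_of_mem (show Pi ω ∈ t from hωt) (show Pi τ ∈ t from hτ)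
      rw [Prod.edist_eq] at hed
      have h1 : ENNReal.ofReal |PiOne m d g ω - PiOne m d g τ| ≤ Metric.ediam t := by
        rw [← Real.dist_eq, ← edist_dist]; exact (le_max_left _ _).trans hed
      have h2 : ENNReal.ofReal |PiOne m d l ω - PiOne m d l τ| ≤ Metric.ediam t := by
        rw [← Real.dist_eq, ← edist_dist]; exact (le_max_right _ _).trans hed
      have hmono : ∀ {x y : ℝ≥0∞} {c : ℝ}, 0 < c → x ≤ y → y ^ (-c) ≤ x ^ (-c) := by
        intro x y c hc hxy
        rw [ENNReal.rpow_neg, ENNReal.rpow_neg]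
        exact ENNReal.inv_le_inv.2 (ENNReal.rpow_le_rpow hxy hc.le)
      calc (Metric.ediam t) ^ (-(a+b)) = (Metric.ediam t) ^ (-a) * (Metric.ediam t) ^ (-b) := by
            by_cases hz : Metric.ediam t = 0
            · rw [hz, ENNReal.zero_rpow_of_neg (by linarith), ENNReal.zero_rpow_of_neg (by linarith),
                ENNReal.zero_rpow_of_neg (by linarith)]
              simp
            · rw [neg_add, ENNReal.rpow_add _ _ hz (ne_top_of_le_ne_top ENNReal.one_ne_top hs1)]
        _ ≤ HH m d a b g l (ω, τ) := by
            unfold HH ee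
            exact mul_le_mul' (hmono ha h1) (hmono hb h2)
    have hint : (Metric.ediam t) ^ (-(a+b)) * ρ (Pi ⁻¹' t) ≤ M := by
      calc (Metric.ediam t) ^ (-(a+b)) * ρ (Pi ⁻¹' t) = ∫⁻ τ in Pi ⁻¹' t, (Metric.ediam t) ^ (-(a+b)) ∂ρ := by
            rw [setLIntegral_const]
        _ ≤ ∫⁻ τ in Pi ⁻¹' t, HH m d a b g l (ω, τ) ∂ρ := 
            setLIntegral_mono' (hPim htm) hlow
        _ ≤ φ ω := setLIntegral_le_lintegral _ _
        _ ≤ M := hωA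
    have hρle : ρ (Pi ⁻¹' t) ≤ M * (Metric.ediam t) ^ (a+b) := by
      rw [ENNReal.rpow_neg, mul_comm, ← div_eq_mul_inv] at hint
      rw [ENNReal.div_le_iff_le_mul (Or.inr hMt) (Or.inr hM0)] at hint
      exact hint
    calc M⁻¹ * ρ (Pi ⁻¹' t ∩ A) ≤ M⁻¹ * (M * (Metric.ediam t) ^ (a+b)) := by
          gcongr
          exact (measure_mono inter_subset_left).trans hρle
      _ = (Metric.ediam t) ^ (a+b) := by
          rw [← mul_assoc, ENNReal.inv_mul_cancel hM0 hMt, one_mul]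
  have hpos : 0 < (M⁻¹ • (ρ.restrict A).map Pi) (Kaff m d g l) := by
    rw [Measure.smul_apply, smul_eq_mul]
    refine ENNReal.mul_pos (ENNReal.inv_ne_zero.2 hMt) ?_
    have h1 := Measure.le_map_apply hPim.aemeasurable (μ := ρ.restrict A) (Kaff m d g l)
    have h2 : Pi ⁻¹' (Kaff m d g l) = univ := by
      ext ω
      simp only [mem_preimage, mem_univ, iff_true]
      exact ⟨ω, rfl⟩
    rw [h2, Measure.restrict_apply_univ] at h1
    exact (hApos.trans_le h1).ne'
  have := le_dimH_of_hausdorffMeasure_ne_zero (s := Kaff m d g l) (d := ⟨a + b, hs.le⟩)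
    (hpos.trans_le (hle _)).ne'
  refine le_trans (le_of_eq ?_) this
  rw [ENNReal.ofReal, Real.toNNReal_of_nonneg hs.le]
  rfl

lemma PiOne_split (m : ℕ) (d : Fin m → ℝ) {x : ℝ} (hx : 0 < x) (hx1 : x < 1) (ω : ℕ → Fin m) (n : ℕ) :
    PiOne m d x ω = ∑ i : Fin n, d (ω i) * x ^ (i : ℕ) + x ^ n * PiOne m d x (fun k => ω (k + n)) := by
  unfold PiOne
  rw [← (PiOne_summable m d hx.le hx1 ω).sum_add_tsum_nat_add n, ← tsum_mul_left,
    Fin.sum_univ_eq_sum_range (fun i => d (ω i) * x ^ i)]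
  congr 1
  refine tsum_congr fun k => ?_
  ring

lemma PiOne_bound (m : ℕ) (d : Fin m → ℝ) {x M : ℝ} (hM : ∀ i, |d i| ≤ M)
    (hx : 0 < x) (hx1 : x < 1) (ω : ℕ → Fin m) :
    |PiOne m d x ω| ≤ M / (1 - x) := by
  unfold PiOne
  have h := (hasSum_geometric_of_lt_one hx.le hx1).mul_left M
  rw [← div_eq_mul_inv] at h
  refine tsum_of_norm_bounded (f := fun n => d (ω n) * x ^ n) h (fun n => ?_)
  rw [Real.norm_eq_abs, abs_mul, abs_of_nonneg (pow_nonneg hx.le n)]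
  gcongr
  exact hM _

lemma dim_upper {m : ℕ} (hm : 2 ≤ m) (d : Fin m → ℝ) {g l : ℝ} (hg : 0 < g) (hgl : g < l)
    (hl1 : l < 1) (hml : 1 < m * l) :
    dimH (Kaff m d g l) ≤ ENNReal.ofReal (1 + Real.log (m * l) / Real.log (1 / g)) := by
  obtain ⟨M, hM0, hM⟩ := exists_bd m d
  have hl : 0 < l := hg.trans hgl
  have hg1 : g < 1 := hgl.trans hl1
  have hmpos : (0:ℝ) < m := by exact_mod_cast (show 0 < m by omega)
  set t := Real.log (m * l) / Real.log (1 / g) with ht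
  have hlogg : 0 < Real.log (1 / g) := Real.log_pos (by rw [lt_div_iff₀ hg]; linarith)
  have ht0 : 0 < t := div_pos (Real.log_pos hml) hlogg
  have hgt : m * l * g ^ t = 1 := by
    have : g ^ t = (m * l)⁻¹ := by
      rw [← Real.exp_log (show 0 < (m*l)⁻¹ by positivity), Real.rpow_def_of_pos hg]
      congr 1
      rw [Real.log_inv, ht]
      have : Real.log (1/g) = - Real.log g := by rw [one_div, Real.log_inv]
      rw [this] at hlogg ⊢
      have : Real.log g ≠ 0 := by linarith
      field_simp
    rw [this]; field_simp
  set D : ℝ := M / (1 - l) + 1 with hD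
  have hD1 : 1 ≤ D := by
    have : 0 ≤ M / (1 - l) := div_nonneg hM0 (by linarith)
    linarith
  have hDl : ∀ ω, |PiOne m d l ω| ≤ D := fun ω => (PiOne_bound m d hM hl hl1 ω).trans (by linarith)
  have hDg : ∀ ω, |PiOne m d g ω| ≤ D := fun ω => (PiOne_bound m d hM hg hg1 ω).trans (by
    have : M / (1 - g) ≤ M / (1 - l) := div_le_div_of_nonneg_left hM0 (by linarith) (by linarith)
    linarith)
  set s := 1 + t with hs
  have hs0 : 0 < s := by linarith
  let ι : ℕ → Type := fun n => (Fin n → Fin m) × Fin (⌊2 * D * (l / g) ^ n⌋₊ + 1)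
  let T : ∀ n, ι n → Set (ℝ × ℝ) := fun n w =>
    Metric.closedBall (∑ i : Fin n, d (w.1 i) * g ^ (i : ℕ),
      ∑ i : Fin n, d (w.1 i) * l ^ (i : ℕ) - l ^ n * D + (w.2 : ℕ) * g ^ n) (D * g ^ n)
  let r : ℕ → ℝ≥0∞ := fun n => ENNReal.ofReal (2 * D * g ^ n)
  have hdiam : ∀ n (w : ι n), Metric.ediam (T n w) ≤ r n := by
    intro n w
    refine Metric.ediam_le fun x hx y hy => ?_
    rw [edist_dist]
    apply ENNReal.ofReal_le_ofReal
    have h1 := Metric.mem_closedBall.1 hx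
    have h2 := Metric.mem_closedBall'.1 hy
    have := dist_triangle x _ y |>.trans (add_le_add h1 h2)
    linarith
  have hcov : ∀ n, Kaff m d g l ⊆ ⋃ w, T n w := by
    rintro n p ⟨ω, rfl⟩
    set y := PiOne m d l (fun k => ω (k + n)) with hy
    set x := PiOne m d g (fun k => ω (k + n)) with hx
    have hyD := abs_le.1 (hDl (fun k => ω (k + n)))
    have hxD := hDg (fun k => ω (k + n))
    rw [← hy] at hyD
    rw [← hx] at hxD
    have hgn : 0 < g ^ n := pow_pos hg n
    have hln : 0 < l ^ n := pow_pos hl n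
    set z := l ^ n * (y + D) / g ^ n with hz
    have hz0 : 0 ≤ z := div_nonneg (mul_nonneg hln.le (by linarith)) hgn.le
    have hzle : z ≤ 2 * D * (l / g) ^ n := by
      rw [hz, div_pow, mul_div_assoc', div_le_div_iff_of_pos_right hgn]
      nlinarith
    have hk : ⌊z⌋₊ < ⌊2 * D * (l / g) ^ n⌋₊ + 1 := Nat.lt_succ_of_le (Nat.floor_le_floor hzle)
    refine mem_iUnion.2 ⟨(fun i => ω i, ⟨⌊z⌋₊, hk⟩), ?_⟩
    change _ ∈ Metric.closedBall _ _
    rw [Metric.mem_closedBall, Prod.dist_eq]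
    refine max_le ?_ ?_
    · change dist (PiOne m d g ω) _ ≤ _
      rw [PiOne_split m d hg hg1 ω n, Real.dist_eq, add_sub_cancel_left, abs_mul, abs_of_pos hgn,
        mul_comm]
      gcongr
    · change dist (PiOne m d l ω) _ ≤ _
      rw [PiOne_split m d hl hl1 ω n, Real.dist_eq, ← hy]
      have h1 := Nat.floor_le hz0
      have h2 := Nat.lt_floor_add_one z
      have hzz : l ^ n * (y + D) = z * g ^ n := by rw [hz]; field_simp
      have : ∑ i : Fin n, d (ω i) * l ^ (i : ℕ) + l ^ n * y -
          (∑ i : Fin n, d (ω i) * l ^ (i : ℕ) - l ^ n * D + (⌊z⌋₊ : ℝ) * g ^ n) = (z - ⌊z⌋₊) * g ^ n := by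
        rw [sub_mul, ← hzz]; ring
      rw [this, abs_mul, abs_of_pos hgn, abs_of_nonneg (by linarith)]
      gcongr
      linarith
  have hr : Tendsto r atTop (𝓝 0) := by
    have : Tendsto (fun n => 2 * D * g ^ n) atTop (𝓝 0) := by
      simpa using (tendsto_pow_atTop_nhds_zero_of_lt_one hg.le hg1).const_mul (2 * D)
    simpa using ENNReal.tendsto_ofReal this
  have hle := Measure.hausdorffMeasure_le_liminf_sum s (Kaff m d g l) r hr T
    (Eventually.of_forall hdiam) (Eventually.of_forall hcov)
  have hsum : ∀ n, ∑ w, Metric.ediam (T n w) ^ s ≤ ENNReal.ofReal ((2 * D + 1) * (2 * D) ^ s) := by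
    intro n
    have hgn : 0 < g ^ n := pow_pos hg n
    calc ∑ w, Metric.ediam (T n w) ^ s ≤ ∑ w : ι n, r n ^ s :=
          Finset.sum_le_sum fun w _ => ENNReal.rpow_le_rpow (hdiam n w) hs0.le
      _ = ENNReal.ofReal ((m ^ n * (⌊2 * D * (l / g) ^ n⌋₊ + 1 : ℝ)) * (2 * D * g ^ n) ^ s) := by
          rw [Finset.sum_const, nsmul_eq_mul, ENNReal.ofReal_mul (by positivity)]
          congr 1
          · simp only [ι, Finset.card_univ, Fintype.card_prod, Fintype.card_fun, Fintype.card_fin]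
            rw [← ENNReal.ofReal_natCast]
            push_cast
            rfl
          · exact ENNReal.ofReal_rpow_of_pos (by positivity)
      _ ≤ ENNReal.ofReal ((2 * D + 1) * (2 * D) ^ s) := by
          apply ENNReal.ofReal_le_ofReal
          have h1 : (⌊2 * D * (l / g) ^ n⌋₊ : ℝ) ≤ 2 * D * (l / g) ^ n := Nat.floor_le (by positivity)
          have h2 : 1 ≤ (l / g) ^ n := one_le_pow₀ (by rw [le_div_iff₀ hg]; linarith)
          have h3 : (2 * D * g ^ n) ^ s = (2 * D) ^ s * (g * g ^ t) ^ n := by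
            rw [Real.mul_rpow (by positivity) hgn.le, hs, Real.rpow_add hgn, Real.rpow_one, mul_pow,
              ← Real.rpow_natCast g n, ← Real.rpow_mul hg.le, ← Real.rpow_natCast (g ^ t) n,
              ← Real.rpow_mul hg.le, mul_comm (n:ℝ) t]
          rw [h3]
          calc (m ^ n * (⌊2 * D * (l / g) ^ n⌋₊ + 1 : ℝ)) * ((2 * D) ^ s * (g * g ^ t) ^ n)
              ≤ (m ^ n * ((2 * D + 1) * (l / g) ^ n)) * ((2 * D) ^ s * (g * g ^ t) ^ n) := by
                gcongr
                linarith
            _ = (2 * D + 1) * (2 * D) ^ s * (m * (l / g) * (g * g ^ t)) ^ n := by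
                rw [mul_pow, mul_pow]; ring
            _ = (2 * D + 1) * (2 * D) ^ s := by
                have : m * (l / g) * (g * g ^ t) = m * l * g ^ t := by field_simp
                rw [this, hgt, one_pow, mul_one]
  have hfin : μH[s] (Kaff m d g l) ≠ ⊤ := by
    refine ne_top_of_le_ne_top ENNReal.ofReal_ne_top (hle.trans
      ((liminf_le_liminf (Eventually.of_forall hsum)).trans (liminf_const _).le))
  have := dimH_le_of_hausdorffMeasure_ne_top (s := Kaff m d g l) (d := ⟨s, hs0.le⟩) hfin
  refine le_trans this (le_of_eq ?_)
  rw [ENNReal.ofReal, Real.toNNReal_of_nonneg hs0.le]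
  rfl

lemma half_ae {α β X : Type*} [MeasurableSpace α] [MeasurableSpace β] [MeasurableSpace X]
    (μ : Measure α) (ν : Measure β) (P : Measure X) [SFinite μ] [SFinite ν] [SFinite P]
    (u : α → X → ℝ≥0∞) (v : β → X → ℝ≥0∞) (hu : Measurable (fun z : α × X => u z.1 z.2))
    (hv : Measurable (fun z : β × X => v z.1 z.2)) (C : ℝ≥0∞) (hC : C ≠ ⊤)
    (hfin : ∀ᵐ y ∂ν, ∫⁻ p, v y p ∂P ≠ ⊤) :
    (∀ᵐ z ∂(μ.prod ν), ∫⁻ p in {p | ∫⁻ x, u x p ∂μ ≤ C}, u z.1 p * v z.2 p ∂P < ⊤) ∧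
    (∀ᵐ z ∂(ν.prod μ), ∫⁻ p in {p | ∫⁻ x, u x p ∂μ ≤ C}, v z.1 p * u z.2 p ∂P < ⊤) := by
  set G : Set X := {p | ∫⁻ x, u x p ∂μ ≤ C} with hG
  have hum : Measurable (fun p => ∫⁻ x, u x p ∂μ) :=
    Measurable.lintegral_prod_right (f := fun p x => u x p) (hu.comp measurable_swap)
  have hGm : MeasurableSet G := hum measurableSet_Iic
  have hF : Measurable (fun z : β × α => ∫⁻ p in G, v z.1 p * u z.2 p ∂P) := by
    refine Measurable.lintegral_prod_right (f := fun (z : β × α) p => v z.1 p * u z.2 p) ?_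
    exact (hv.comp ((measurable_fst.comp measurable_fst).prodMk measurable_snd)).mul
      (hu.comp ((measurable_snd.comp measurable_fst).prodMk measurable_snd))
  have hset : MeasurableSet {z : β × α | ∫⁻ p in G, v z.1 p * u z.2 p ∂P < ⊤} :=
    measurableSet_lt hF measurable_const
  have hae : ∀ᵐ y ∂ν, ∀ᵐ x ∂μ, ∫⁻ p in G, v y p * u x p ∂P < ⊤ := by
    filter_upwards [hfin] with y hy
    have hvy : Measurable (fun p => v y p) := hv.comp measurable_prodMk_left
    refine ae_lt_top (hF.comp measurable_prodMk_left) ?_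
    have hsw : ∫⁻ x, ∫⁻ p in G, v y p * u x p ∂P ∂μ = ∫⁻ p in G, ∫⁻ x, v y p * u x p ∂μ ∂P := by
      refine lintegral_lintegral_swap ?_
      exact ((hvy.comp measurable_snd).mul hu).aemeasurable
    change ∫⁻ x, ∫⁻ p in G, v y p * u x p ∂P ∂μ ≠ ⊤
    rw [hsw]
    refine ne_top_of_le_ne_top (ENNReal.mul_ne_top hy hC) ?_
    calc ∫⁻ p in G, ∫⁻ x, v y p * u x p ∂μ ∂P ≤ ∫⁻ p in G, v y p * C ∂P := by
          refine setLIntegral_mono' hGm fun p hp => ?_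
          have hup : Measurable (fun x => u x p) := hu.comp measurable_prodMk_right
          rw [lintegral_const_mul _ hup]
          gcongr
          exact hp
      _ = (∫⁻ p in G, v y p ∂P) * C := lintegral_mul_const _ hvy
      _ ≤ (∫⁻ p, v y p ∂P) * C := by
          gcongr
          exact Measure.restrict_le_self
  refine ⟨?_, (Measure.ae_prod_iff_ae_ae hset).2 hae⟩
  have h2 := (Measure.ae_ae_comm (p := fun y x => ∫⁻ p in G, v y p * u x p ∂P < ⊤) hset).1 hae
  have hset' : MeasurableSet {z : α × β | ∫⁻ p in G, v z.2 p * u z.1 p ∂P < ⊤} :=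
    measurable_swap hset
  have h3 := (Measure.ae_prod_iff_ae_ae (p := fun z : α × β => ∫⁻ p in G, v z.2 p * u z.1 p ∂P < ⊤)
    hset').2 h2
  simpa only [mul_comm] using h3

lemma eeUU_meas (m : ℕ) (d : Fin m → ℝ) {q : ℝ} (hq0 : 0 ≤ q) (hq1 : q < 1) (a : ℝ) :
    Measurable (fun z : ℝ × ((ℕ → Fin m) × (ℕ → Fin m)) => ee a (UU m d q z.1 z.2)) :=
  (ee_meas a).comp (UU_continuous m d hq0 hq1).measurable

lemma HH_eq (m : ℕ) (d : Fin m → ℝ) {q a b g l : ℝ} (hg : g ∈ Ioo 0 q) (hl : l ∈ Ioo 0 q)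
    (p : (ℕ → Fin m) × (ℕ → Fin m)) :
    HH m d a b g l p = ee a (UU m d q g p) * ee b (UU m d q l p) := by
  unfold HH UU
  rw [FF_eq m d hg.1.le hg.2.le, FF_eq m d hg.1.le hg.2.le, FF_eq m d hl.1.le hl.2.le,
    FF_eq m d hl.1.le hl.2.le]

/-- finite energy of `ν_x`. -/
def FinE (m : ℕ) (d : Fin m → ℝ) (ρ : Measure (ℕ → Fin m)) (q a x : ℝ) : Prop :=
  ∫⁻ p, ee a (UU m d q x p) ∂(ρ.prod ρ) ≠ ⊤

lemma finE_of_corr (m : ℕ) (d : Fin m → ℝ) (ρ : Measure (ℕ → Fin m)) [IsProbabilityMeasure ρ]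
    {q a x : ℝ} (hq1 : q < 1) (hx : x ∈ Ioo 0 q) (ha : 0 < a) (ha1 : a < 1)
    (h : lowerCorrDim (ρ.map (PiOne m d x)) = 1) : FinE m d ρ q a x := by
  unfold FinE UU
  simp_rw [FF_eq m d hx.1.le hx.2.le]
  exact corr_energy m d ρ hx.1 (hx.2.trans hq1) h ha ha1

lemma localJ (m : ℕ) (d : Fin m → ℝ) (ρ : Measure (ℕ → Fin m)) [IsProbabilityMeasure ρ]
    {q a b : ℝ} (hq0 : 0 ≤ q) (hq1 : q < 1) {A1 A2 : Set ℝ} (hA1 : A1 ⊆ Ioo 0 q) (hA2 : A2 ⊆ Ioo 0 q)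
    (hA1o : IsOpen A1) (hA2o : IsOpen A2) (C : ℝ≥0∞) (hC : C ≠ ⊤)
    (h : ∀ p ∈ (agree0 m)ᶜ, ∫⁻ x in A1, ee a (UU m d q x p) ≤ C)
    (hE : ∀ᵐ y ∂(volume.restrict A2), FinE m d ρ q b y) :
    ∀ᵐ z : ℝ × ℝ, z ∈ A1 ×ˢ A2 → ∫⁻ p in (agree0 m)ᶜ, HH m d a b z.1 z.2 p ∂(ρ.prod ρ) ≠ ⊤ := by
  have h1 := (half_ae (volume.restrict A1) (volume.restrict A2) (ρ.prod ρ)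
    (fun x p => ee a (UU m d q x p)) (fun y p => ee b (UU m d q y p))
    (eeUU_meas m d hq0 hq1 a) (eeUU_meas m d hq0 hq1 b) C hC hE).1
  rw [Measure.prod_restrict, ← Measure.volume_eq_prod,
    ae_restrict_iff' (hA1o.measurableSet.prod hA2o.measurableSet)] at h1
  filter_upwards [h1] with z hz hzA
  refine ne_top_of_le_ne_top (hz hzA).ne ?_
  simp_rw [HH_eq m d (hA1 hzA.1) (hA2 hzA.2)]
  exact lintegral_mono_set h

lemma localR (m : ℕ) (d : Fin m → ℝ) (ρ : Measure (ℕ → Fin m)) [IsProbabilityMeasure ρ]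
    {q a b : ℝ} (hq0 : 0 ≤ q) (hq1 : q < 1) {A1 A2 : Set ℝ} (hA1 : A1 ⊆ Ioo 0 q) (hA2 : A2 ⊆ Ioo 0 q)
    (hA1o : IsOpen A1) (hA2o : IsOpen A2) (C1 C2 : ℝ≥0∞) (hC1 : C1 ≠ ⊤) (hC2 : C2 ≠ ⊤)
    (h : ∀ p ∈ (agree0 m)ᶜ, ∫⁻ x in A1, ee a (UU m d q x p) ≤ C1 ∨ ∫⁻ x in A2, ee b (UU m d q x p) ≤ C2)
    (hE1 : ∀ᵐ y ∂(volume.restrict A1), FinE m d ρ q a y)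
    (hE : ∀ᵐ y ∂(volume.restrict A2), FinE m d ρ q b y) :
    ∀ᵐ z : ℝ × ℝ, z ∈ A1 ×ˢ A2 → ∫⁻ p in (agree0 m)ᶜ, HH m d a b z.1 z.2 p ∂(ρ.prod ρ) ≠ ⊤ := by
  have h1 := (half_ae (volume.restrict A1) (volume.restrict A2) (ρ.prod ρ)
    (fun x p => ee a (UU m d q x p)) (fun y p => ee b (UU m d q y p))
    (eeUU_meas m d hq0 hq1 a) (eeUU_meas m d hq0 hq1 b) C1 hC1 hE).1
  have h2 := (half_ae (volume.restrict A2) (volume.restrict A1) (ρ.prod ρ)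
    (fun x p => ee b (UU m d q x p)) (fun y p => ee a (UU m d q y p))
    (eeUU_meas m d hq0 hq1 b) (eeUU_meas m d hq0 hq1 a) C2 hC2 hE1).2
  rw [Measure.prod_restrict, ← Measure.volume_eq_prod,
    ae_restrict_iff' (hA1o.measurableSet.prod hA2o.measurableSet)] at h1 h2
  filter_upwards [h1, h2] with z hz hz2 hzA
  refine ne_top_of_le_ne_top (ENNReal.add_ne_top.2 ⟨(hz hzA).ne, (hz2 hzA).ne⟩) ?_
  simp_rw [HH_eq m d (hA1 hzA.1) (hA2 hzA.2)]
  exact (lintegral_mono_set h).trans (lintegral_union_le _ _ _)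

lemma agree0_compl_compact (m : ℕ) : IsCompact ((agree0 m)ᶜ) := by
  apply IsClosed.isCompact
  rw [isClosed_compl_iff]
  have : agree0 m = (fun p : (ℕ → Fin m) × (ℕ → Fin m) => (p.1 0, p.2 0)) ⁻¹' (diagonal (Fin m)) := by
    ext p; rfl
  rw [this]
  exact (isOpen_discrete _).preimage (by fun_prop)

lemma UUc (m : ℕ) (d : Fin m → ℝ) {q : ℝ} (hq0 : 0 ≤ q) (hq1 : q < 1) (x : ℝ) :
    Continuous (UU m d q x) := (UU_continuous m d hq0 hq1).comp (Continuous.prodMk_right x)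

lemma VVc (m : ℕ) (d : Fin m → ℝ) {q : ℝ} (hq0 : 0 ≤ q) (hq1 : q < 1) (x : ℝ) :
    Continuous (VV m d q x) := (VV_continuous m d hq0 hq1).comp (Continuous.prodMk_right x)

/-- Local a.e. statement at a point of the first type. -/
lemma pointR (m : ℕ) (d : Fin m → ℝ) (hd : StrictMono d)
    (ρ : Measure (ℕ → Fin m)) [IsProbabilityMeasure ρ]
    {i1 i2 : ℝ} (hIdim : ∀ᵐ l : ℝ ∂volume, l ∈ Ioo i1 i2 → lowerCorrDim (ρ.map (PiOne m d l)) = 1)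
    {a b : ℝ} (ha : 0 < a) (ha1 : a < 1) (hb : 0 < b) (hb1 : b < 1)
    {g l : ℝ} (hg : 0 < g) (hg1 : g < 1) (hl : 0 < l) (hl1 : l < 1)
    (hgI : g ∈ Ioo i1 i2) (hlI : l ∈ Ioo i1 i2)
    (h : ∀ c, memB m d c → ¬ (HasDoubleRootAt c g ∧ HasDoubleRootAt c l)) :
    ∃ U ∈ 𝓝 (g, l), ∀ᵐ z : ℝ × ℝ, z ∈ U →
      ∫⁻ p in (agree0 m)ᶜ, HH m d a b z.1 z.2 p ∂(ρ.prod ρ) ≠ ⊤ := by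
  obtain ⟨q, hq, hq1⟩ := exists_between (max_lt hg1 hl1)
  have hgq : g < q := (le_max_left _ _).trans_lt hq
  have hlq : l < q := (le_max_right _ _).trans_lt hq
  have hq0 : 0 ≤ q := by linarith
  obtain ⟨δ, hδ, hδle⟩ := (agree0_compl_compact m).exists_forall_le' (a := (0:ℝ))
    (f := fun p => max (max |UU m d q g p| |VV m d q g p|) (max |UU m d q l p| |VV m d q l p|))
    ((((UUc m d hq0 hq1 g).abs.max (VVc m d hq0 hq1 g).abs).max
      ((UUc m d hq0 hq1 l).abs.max (VVc m d hq0 hq1 l).abs)).continuousOn) (by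
      intro p hp
      by_contra hcon
      simp only [not_lt, max_le_iff, abs_nonpos_iff] at hcon
      refine h (cc m d p) (memB_cc m d hd p hp) ⟨?_, ?_⟩
      · exact (doubleRoot_iff m d hq1 hg hgq p).2 hcon.1
      · exact (doubleRoot_iff m d hq1 hl hlq p).2 hcon.2)
  obtain ⟨η1, hη1, C1, hC1, hsub1, htr1⟩ := transversal m d hq1 hg hgq hδ ha ha1
  obtain ⟨η2, hη2, C2, hC2, hsub2, htr2⟩ := transversal m d hq1 hl hlq hδ hb hb1
  set A1 := Ioo (g - η1) (g + η1) ∩ Ioo i1 i2 with hA1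
  set A2 := Ioo (l - η2) (l + η2) ∩ Ioo i1 i2 with hA2
  have hA1o : IsOpen A1 := isOpen_Ioo.inter isOpen_Ioo
  have hA2o : IsOpen A2 := isOpen_Ioo.inter isOpen_Ioo
  have s1 : A1 ⊆ Ioo 0 q := inter_subset_left.trans hsub1
  have s2 : A2 ⊆ Ioo 0 q := inter_subset_left.trans hsub2
  refine ⟨A1 ×ˢ A2, prod_mem_nhds (hA1o.mem_nhds ⟨⟨by linarith, by linarith⟩, hgI⟩)
    (hA2o.mem_nhds ⟨⟨by linarith, by linarith⟩, hlI⟩), ?_⟩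
  refine localR m d ρ hq0 hq1 s1 s2 hA1o hA2o C1 C2 hC1 hC2 ?_ ?_ ?_
  · intro p hp
    rcases le_max_iff.1 (hδle p hp) with h | h
    · left
      exact (lintegral_mono_set inter_subset_left).trans (htr1 p (le_max_iff.1 h))
    · right
      exact (lintegral_mono_set inter_subset_left).trans (htr2 p (le_max_iff.1 h))
  · rw [ae_restrict_iff' hA1o.measurableSet]
    filter_upwards [hIdim] with x hx hxA
    exact finE_of_corr m d ρ hq1 (s1 hxA) ha ha1 (hx hxA.2)
  · rw [ae_restrict_iff' hA2o.measurableSet]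
    filter_upwards [hIdim] with x hx hxA
    exact finE_of_corr m d ρ hq1 (s2 hxA) hb hb1 (hx hxA.2)

/-- Local a.e. statement at a point of the second type. -/
lemma pointJ (m : ℕ) (d : Fin m → ℝ) (hd : StrictMono d)
    (ρ : Measure (ℕ → Fin m)) [IsProbabilityMeasure ρ]
    {i1 i2 : ℝ} (hIdim : ∀ᵐ l : ℝ ∂volume, l ∈ Ioo i1 i2 → lowerCorrDim (ρ.map (PiOne m d l)) = 1)
    {a b : ℝ} (ha : 0 < a) (ha1 : a < 1) (hb : 0 < b) (hb1 : b < 1)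
    {g l : ℝ} (hg : 0 < g) (hg1 : g < 1) (hl : 0 < l) (hl1 : l < 1)
    (hlI : l ∈ Ioo i1 i2)
    (h : ∀ c, memB m d c → ¬ HasDoubleRootAt c g) :
    ∃ U ∈ 𝓝 (g, l), ∀ᵐ z : ℝ × ℝ, z ∈ U →
      ∫⁻ p in (agree0 m)ᶜ, HH m d a b z.1 z.2 p ∂(ρ.prod ρ) ≠ ⊤ := by
  obtain ⟨q, hq, hq1⟩ := exists_between (max_lt hg1 hl1)
  have hgq : g < q := (le_max_left _ _).trans_lt hq
  have hlq : l < q := (le_max_right _ _).trans_lt hq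
  have hq0 : 0 ≤ q := by linarith
  obtain ⟨δ, hδ, hδle⟩ := (agree0_compl_compact m).exists_forall_le' (a := (0:ℝ))
    (f := fun p => max |UU m d q g p| |VV m d q g p|)
    ((UUc m d hq0 hq1 g).abs.max (VVc m d hq0 hq1 g).abs).continuousOn (by
      intro p hp
      by_contra hcon
      simp only [not_lt, max_le_iff, abs_nonpos_iff] at hcon
      exact h (cc m d p) (memB_cc m d hd p hp) ((doubleRoot_iff m d hq1 hg hgq p).2 hcon))
  obtain ⟨η1, hη1, C1, hC1, hsub1, htr1⟩ := transversal m d hq1 hg hgq hδ ha ha1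
  set A1 := Ioo (g - η1) (g + η1) with hA1
  set A2 := Ioo 0 q ∩ Ioo i1 i2 with hA2
  have hA1o : IsOpen A1 := isOpen_Ioo
  have hA2o : IsOpen A2 := isOpen_Ioo.inter isOpen_Ioo
  have s2 : A2 ⊆ Ioo 0 q := inter_subset_left
  refine ⟨A1 ×ˢ A2, prod_mem_nhds (hA1o.mem_nhds ⟨by linarith, by linarith⟩)
    (hA2o.mem_nhds ⟨⟨hl, hlq⟩, hlI⟩), ?_⟩
  refine localJ m d ρ hq0 hq1 hsub1 s2 hA1o hA2o C1 hC1 ?_ ?_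
  · intro p hp
    exact htr1 p (le_max_iff.1 (hδle p hp))
  · rw [ae_restrict_iff' hA2o.measurableSet]
    filter_upwards [hIdim] with x hx hxA
    exact finE_of_corr m d ρ hq1 (s2 hxA) hb hb1 (hx hxA.2)

lemma ae_of_local {S : Set (ℝ × ℝ)} {Q : ℝ × ℝ → Prop}
    (h : ∀ x ∈ S, ∃ U ∈ 𝓝 x, ∀ᵐ z : ℝ × ℝ, z ∈ U → Q z) :
    ∀ᵐ z : ℝ × ℝ, z ∈ S → Q z := by
  have key : (volume : Measure (ℝ × ℝ)) {z | z ∈ S ∧ ¬ Q z} = 0 := by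
    refine measure_null_of_locally_null _ fun x hx => ?_
    obtain ⟨U, hU, hQ⟩ := h x hx.1
    refine ⟨U ∩ {z | z ∈ S ∧ ¬ Q z}, inter_mem (mem_nhdsWithin_of_mem_nhds hU) self_mem_nhdsWithin, ?_⟩
    refine measure_mono_null ?_ (ae_iff.1 hQ)
    rintro z ⟨hzU, _, hz⟩
    simp only [mem_setOf_eq, Classical.not_imp]
    exact ⟨hzU, hz⟩
  rw [ae_iff]
  refine measure_mono_null ?_ key
  intro z hz
  simpa only [mem_setOf_eq, Classical.not_imp] using hz

lemma dim_lower_sup {m : ℕ} (hm : 2 ≤ m) (ρ : Measure (ℕ → Fin m))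
    (hρ : IsBernoulliWith (fun _ => (m : ℝ≥0∞)⁻¹) ρ) (d : Fin m → ℝ) {g l : ℝ}
    (hg : 0 < g) (hgl : g < l) (hl1 : l < 1) (hml : 1 < m * l) (hgm : g * l < 1 / m)
    (h : ∀ a b : ℚ, 0 < (a : ℝ) → (a : ℝ) < 1 → 0 < (b : ℝ) → (b : ℝ) < 1 →
      ∫⁻ p in (agree0 m)ᶜ, HH m d a b g l p ∂(ρ.prod ρ) ≠ ⊤) :
    ENNReal.ofReal (1 + Real.log (m * l) / Real.log (1 / g)) ≤ dimH (Kaff m d g l) := by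
  have := hρ.1
  have hl : 0 < l := hg.trans hgl
  have hg1 : g < 1 := hgl.trans hl1
  have hmpos : (0:ℝ) < m := by exact_mod_cast (show 0 < m by omega)
  have hlogg : Real.log g < 0 := Real.log_neg hg hg1
  have hlogl : Real.log l < 0 := Real.log_neg hl hl1
  have hlogml : 0 < Real.log (m * l) := Real.log_pos hml
  have hsplit : Real.log (m * l) = Real.log m + Real.log l := Real.log_mul hmpos.ne' hl.ne'
  have hinv : Real.log (1 / g) = - Real.log g := by rw [one_div, Real.log_inv]
  set t := Real.log (m * l) / Real.log (1 / g) with ht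
  have hL : 0 < Real.log (1 / g) := by rw [hinv]; linarith
  have ht0 : 0 < t := div_pos hlogml hL
  have htL : t * Real.log g = - Real.log (m * l) := by
    have hne := hlogg.ne
    rw [ht, hinv]; field_simp
  have ht1 : t < 1 := by
    rw [ht, div_lt_one hL, hinv, hsplit]
    have h1 : m * (g * l) < 1 := by
      rw [lt_div_iff₀ hmpos] at hgm; linarith
    have h2 : Real.log (m * (g * l)) < 0 := Real.log_neg (by positivity) h1
    rw [Real.log_mul hmpos.ne' (by positivity), Real.log_mul hg.ne' hl.ne'] at h2
    linarith
  refine le_of_forall_lt fun c hc => ?_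
  have hctop : c ≠ ⊤ := ne_top_of_lt hc
  set r := c.toReal with hr
  have hcr : c = ENNReal.ofReal r := (ENNReal.ofReal_toReal hctop).symm
  have hrlt : r < 1 + t := by
    rw [hcr] at hc
    exact (ENNReal.ofReal_lt_ofReal_iff (by linarith)).1 hc
  obtain ⟨a, ha1, ha2⟩ := exists_rat_btwn (show max 0 (t - (1 + t - r) / 2) < t from
    max_lt ht0 (by linarith))
  obtain ⟨b, hb1, hb2⟩ := exists_rat_btwn (show max 0 (1 - (1 + t - r) / 2) < (1:ℝ) from
    max_lt one_pos (by linarith))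
  rw [max_lt_iff] at ha1 hb1
  have h0 := h a b ha1.1 (ha2.trans ht1) hb1.1 hb2
  have hcond : 1 < m * (g ^ (a:ℝ) * l ^ (b:ℝ)) := by
    have hga : 0 < g ^ (a:ℝ) := Real.rpow_pos_of_pos hg _
    have hlb : 0 < l ^ (b:ℝ) := Real.rpow_pos_of_pos hl _
    rw [← Real.log_pos_iff (by positivity), Real.log_mul hmpos.ne' (by positivity),
      Real.log_mul hga.ne' hlb.ne', Real.log_rpow hg, Real.log_rpow hl]
    nlinarith [mul_pos (sub_pos.2 ha2) (neg_pos.2 hlogg), mul_pos (sub_pos.2 hb2) (neg_pos.2 hlogl)]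
  have hE := energy_finite hm ρ hρ d a b hg hg1 hl hl1 h0 hcond
  have hD := dim_lower ρ d ha1.1 hb1.1 hg hg1 hl hl1 hE
  refine lt_of_lt_of_le ?_ hD
  rw [hcr, ENNReal.ofReal_lt_ofReal_iff (by linarith [ha1.1, hb1.1])]
  linarith [ha1.2, hb1.2]

/-- Theorem on Hausdorff dimension of the self-affine sets `K_{γ,λ}`, under
(i) a.e. correlation dimension 1 for `ν_λ`, `λ ∈ I`; (ii) no double roots of members of `𝓑`
in `J`; (iii) a transversality region `R` where no `f ∈ 𝓑` has double roots at both `γ`, `λ`. -/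
theorem hausdorff_dimension_general
    (m : ℕ) (hm : 2 ≤ m) (d : Fin m → ℝ) (hd0 : d ⟨0, by omega⟩ = 0) (hd : StrictMono d)
    (ρ : Measure (ℕ → Fin m)) (hρ : IsBernoulliWith (fun _ => (m : ℝ≥0∞)⁻¹) ρ)
    (i1 i2 : ℝ) (hI : Ioo i1 i2 ⊆ Ioo (1 / (m : ℝ)) 1)
    (hIdim : ∀ᵐ l : ℝ ∂volume, l ∈ Ioo i1 i2 →
      lowerCorrDim (ρ.map (PiOne m d l)) = 1)
    (j1 j2 : ℝ) (hJ : Ioo j1 j2 ⊆ Ioo (0 : ℝ) 1)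
    (hJroots : ∀ c : ℕ → ℝ, memB m d c → ∀ α ∈ Ioo j1 j2, ¬ HasDoubleRootAt c α)
    (R : Set (ℝ × ℝ)) (hR : IsOpen R)
    (hRroots : ∀ p ∈ R, ∀ c : ℕ → ℝ, memB m d c →
      ¬ (HasDoubleRootAt c p.1 ∧ HasDoubleRootAt c p.2)) :
    ∀ᵐ p : ℝ × ℝ ∂volume,
      p ∈ (R ∩ (Ioo i1 i2 ×ˢ Ioo i1 i2) ∩ Gamma m 0 (1 / m)) ∪
          ((Ioo j1 j2 ×ˢ Ioo i1 i2) ∩ Gamma m 0 (1 / m)) →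
        dimH (Kaff m d p.1 p.2) =
          ENNReal.ofReal (1 + Real.log (m * p.2) / Real.log (1 / p.1)) := by
  have := hρ.1
  have hmpos : (0:ℝ) < m := by exact_mod_cast (show 0 < m by omega)
  have hae : ∀ᵐ z : ℝ × ℝ ∂volume, ∀ a b : ℚ, 0 < (a : ℝ) → (a : ℝ) < 1 → 0 < (b : ℝ) →
      (b : ℝ) < 1 → z ∈ (R ∩ (Ioo i1 i2 ×ˢ Ioo i1 i2) ∩ Gamma m 0 (1 / m)) ∪
          ((Ioo j1 j2 ×ˢ Ioo i1 i2) ∩ Gamma m 0 (1 / m)) →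
        ∫⁻ p in (agree0 m)ᶜ, HH m d a b z.1 z.2 p ∂(ρ.prod ρ) ≠ ⊤ := by
    rw [ae_all_iff]
    intro a
    rw [ae_all_iff]
    intro b
    by_cases hab : 0 < (a : ℝ) ∧ (a : ℝ) < 1 ∧ 0 < (b : ℝ) ∧ (b : ℝ) < 1
    · obtain ⟨ha, ha1, hb, hb1⟩ := hab
      have key := ae_of_local (S := (R ∩ (Ioo i1 i2 ×ˢ Ioo i1 i2) ∩ Gamma m 0 (1 / m)) ∪
          ((Ioo j1 j2 ×ˢ Ioo i1 i2) ∩ Gamma m 0 (1 / m)))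
        (Q := fun z => ∫⁻ p in (agree0 m)ᶜ, HH m d a b z.1 z.2 p ∂(ρ.prod ρ) ≠ ⊤) (by
          rintro ⟨g, l⟩ (⟨⟨hzR, hgI, hlI⟩, hG⟩ | ⟨⟨hgJ, hlI⟩, hG⟩)
          · obtain ⟨h1, h2, h3, -⟩ := hG
            exact pointR m d hd ρ hIdim ha ha1 hb hb1 h1 (h2.trans h3) (h1.trans h2) h3 hgI hlI
              (hRroots _ hzR)
          · obtain ⟨h1, h2, h3, -⟩ := hG
            exact pointJ m d hd ρ hIdim ha ha1 hb hb1 h1 (h2.trans h3) (h1.trans h2) h3 hlI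
              (fun c hc => hJroots c hc _ hgJ))
      filter_upwards [key] with z hz _ _ _ _ hzS using hz hzS
    · exact Eventually.of_forall fun z h1 h2 h3 h4 => absurd ⟨h1, h2, h3, h4⟩ hab
  filter_upwards [hae] with z hz hzS
  have hG : z ∈ Gamma m 0 (1 / m) := by
    rcases hzS with h | h
    · exact h.2
    · exact h.2
  obtain ⟨h1, h2, h3, h4, -, h6⟩ := hG
  have hml : 1 < m * z.2 := by
    rw [div_lt_iff₀ hmpos] at h4; linarith
  exact le_antisymm (dim_upper hm d h1 h2 h3 hml)
    (dim_lower_sup hm ρ hρ d h1 h2 h3 hml h6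
      (fun a b ha ha1 hb hb1 => hz a b ha ha1 hb hb1 hzS))
end
end

section
/- Let J1, J2 be closed nondegenerate intervals with J1 × J2 ⊂ Γ(0,1/m), and fix 0 < ξ < ε. Suppose λ₀ ∈ J2 and K > 0 satisfy (ν_{λ₀} × ν_{λ₀}){(x,y) : |x−y| ≤ r} ≤ K·r^{1−ξ} for all r > 0, and suppose J1 is a set of transversality for a subset 𝓑̃′ = ⋃_{k≥0} x^k 𝓑′ of 𝓑̃ (with 𝓑′ ⊂ 𝓑). Set γ₀ = min J1 and Dim = 1 + log(mλ₀)/log(1/γ₀). Then ∫_{𝓑̃′} ∫_{J1} |Π_{γ,λ₀}(ω)|^{−Dim+ε} dγ dη(ω) < ∞. -/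
open MeasureTheory Filter Set
open scoped ENNReal Topology

noncomputable section

/-- `η`: the pushforward of `ρ × ρ` under the coordinatewise difference map. -/
def etaMeasure (m : ℕ) (d : Fin m → ℝ) (ρ : Measure (ℕ → Fin m)) : Measure (ℕ → ℝ) :=
  (ρ.prod ρ).map (fun q n => d (q.1 n) - d (q.2 n))

/-- `J` is a set of transversality for `B ⊆ 𝓑`. -/
def IsTransvOn (J : Set ℝ) (B : Set (ℕ → ℝ)) : Prop :=
  ∃ M : ℝ, 0 < M ∧ ∀ c ∈ B, ∀ r : ℝ, 0 < r →
    volume {α ∈ J | |Beval c α| < r} < ENNReal.ofReal (M * r)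

/-- Multiplication of a coefficient sequence by `x^k`. -/
def shiftSeq (k : ℕ) (c : ℕ → ℝ) : ℕ → ℝ := fun n => if n < k then 0 else c (n - k)

/-- Negative moments from a small-ball estimate, with a uniform constant. -/
lemma neg_moment {Ω : Type*} [MeasurableSpace Ω] (μ : Measure Ω) (X : Ω → ℝ) (K a p : ℝ)
    (hp : 0 ≤ p)
    (hX : ∀ r : ℝ, 0 < r → μ {ω | X ω ≤ r} ≤ ENNReal.ofReal (K * r ^ a)) :
    ∫⁻ ω, ENNReal.ofReal (X ω) ^ (-p) ∂μ ≤ μ univ +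
      ∑' n : ℕ, ENNReal.ofReal ((2:ℝ) ^ (p * (n + 1)))
        * ENNReal.ofReal (K * ((1/2:ℝ) ^ n) ^ a) := by
  set S : ℕ → Set Ω := fun n => toMeasurable μ {ω | X ω ≤ (1/2:ℝ) ^ n} with hS
  have hSm : ∀ n, MeasurableSet (S n) := fun n => measurableSet_toMeasurable _ _
  have hsub : ∀ n ω, X ω ≤ (1/2:ℝ) ^ n → ω ∈ S n := fun n ω h => subset_toMeasurable μ _ h
  have hpt : ∀ ω, ENNReal.ofReal (X ω) ^ (-p) ≤ 1 +
      ∑' n : ℕ, (S n).indicator (fun _ => ENNReal.ofReal ((2:ℝ) ^ (p * (n + 1)))) ω := by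
    intro ω
    rcases le_or_gt (X ω) 0 with h0 | h0
    · have : ∑' n : ℕ, (S n).indicator (fun _ => ENNReal.ofReal ((2:ℝ) ^ (p * (n + 1)))) ω = ⊤ := by
        rw [← top_le_iff, ← ENNReal.tsum_const_eq_top_of_ne_zero (α := ℕ) (c := 1) one_ne_zero]
        refine ENNReal.tsum_le_tsum fun n => ?_
        rw [indicator_of_mem (hsub n ω (h0.trans (by positivity)))]
        rw [ENNReal.one_le_ofReal]
        exact Real.one_le_rpow (by norm_num) (by positivity)
      rw [this]; simp
    · rcases le_or_gt (X ω) 1 with h1 | h1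
      · obtain ⟨n, hn1, hn2⟩ := exists_nat_pow_near_of_lt_one h0 h1
          (show (0:ℝ) < 1/2 by norm_num) (by norm_num)
        refine le_trans ?_ (le_trans (ENNReal.le_tsum n) le_add_self)
        rw [indicator_of_mem (hsub n ω hn2), ENNReal.ofReal_rpow_of_pos h0]
        apply ENNReal.ofReal_le_ofReal
        calc X ω ^ (-p) ≤ ((1/2:ℝ) ^ (n+1)) ^ (-p) :=
              Real.rpow_le_rpow_of_nonpos (by positivity) hn1.le (by linarith)
          _ = (2:ℝ) ^ (p * (n + 1)) := by
              rw [← Real.rpow_natCast, ← Real.rpow_mul (by norm_num), one_div,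
                Real.inv_rpow (by norm_num), ← Real.rpow_neg (by norm_num)]
              congr 1; push_cast; ring
      · refine le_trans ?_ le_self_add
        rw [ENNReal.ofReal_rpow_of_pos h0, ENNReal.ofReal_le_one]
        exact Real.rpow_le_one_of_one_le_of_nonpos h1.le (by linarith)
  calc ∫⁻ ω, ENNReal.ofReal (X ω) ^ (-p) ∂μ
      ≤ ∫⁻ ω, (1 + ∑' n : ℕ, (S n).indicator
          (fun _ => ENNReal.ofReal ((2:ℝ) ^ (p * (n + 1)))) ω) ∂μ := lintegral_mono hpt
    _ = μ univ + ∑' n : ℕ, ENNReal.ofReal ((2:ℝ) ^ (p * (n + 1))) * μ (S n) := by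
        rw [lintegral_add_left measurable_const, lintegral_one, lintegral_tsum]
        · congr 1
          refine tsum_congr fun n => ?_
          rw [lintegral_indicator_const (hSm n)]
        · intro n; exact (measurable_const.indicator (hSm n)).aemeasurable
    _ ≤ _ := by
        gcongr with n
        rw [hS]; simp only [measure_toMeasurable]
        exact hX _ (by positivity)

lemma neg_moment_const (K a p : ℝ) (hpa : p < a) :
    ∑' n : ℕ, ENNReal.ofReal ((2:ℝ) ^ (p * (n + 1)))
        * ENNReal.ofReal (K * ((1/2:ℝ) ^ n) ^ a) < ⊤ := by
  have h : ∀ n : ℕ, ENNReal.ofReal ((2:ℝ) ^ (p * (n + 1)))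
        * ENNReal.ofReal (K * ((1/2:ℝ) ^ n) ^ a)
      = ENNReal.ofReal ((2:ℝ)^p * K) * ENNReal.ofReal ((2:ℝ)^(p-a)) ^ n := by
    intro n
    rw [← ENNReal.ofReal_mul (by positivity), ← ENNReal.ofReal_pow (by positivity),
      ← ENNReal.ofReal_mul' (by positivity)]
    congr 1
    rw [← Real.rpow_natCast, ← Real.rpow_natCast, ← Real.rpow_mul (by norm_num),
      ← Real.rpow_mul (by norm_num), one_div,
      Real.inv_rpow (by norm_num), ← Real.rpow_neg (by norm_num)]
    rw [show (2:ℝ)^(p*(n+1)) * (K * 2 ^ (-((n:ℝ) * a))) = K * (2^(p*(n+1)) * 2 ^ (-((n:ℝ) * a))) by ring,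
      show (2:ℝ)^p*K * 2 ^ ((p-a)*n) = K * (2^p * 2 ^ ((p-a)*n)) by ring,
      ← Real.rpow_add (by norm_num), ← Real.rpow_add (by norm_num)]
    congr 2; ring
  simp_rw [h]
  rw [ENNReal.tsum_mul_left, ENNReal.tsum_geometric]
  refine ENNReal.mul_lt_top ENNReal.ofReal_lt_top ?_
  rw [ENNReal.inv_lt_top, tsub_pos_iff_lt, ENNReal.ofReal_lt_one]
  exact Real.rpow_lt_one_of_one_lt_of_neg (by norm_num) (by linarith)

lemma rpow_split {x a y : ℝ≥0∞} {δ p : ℝ} (hx : x ≠ ⊤) (ha : a ≤ x) (hy : y ≤ x)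
    (hδ : 0 ≤ δ) (hp : 0 ≤ p) : x ^ (-(δ + p)) ≤ a ^ (-δ) * y ^ (-p) := by
  have : x ^ (-(δ + p)) = x ^ (-δ) * x ^ (-p) := by
    rw [ENNReal.rpow_neg, ENNReal.rpow_neg, ENNReal.rpow_neg,
      ENNReal.rpow_add_of_nonneg _ _ hδ hp, ENNReal.mul_inv]
    · right; exact ENNReal.rpow_ne_top_of_nonneg hp hx
    · left; exact ENNReal.rpow_ne_top_of_nonneg hδ hx
  rw [this]
  gcongr ?_ * ?_
  · rw [ENNReal.rpow_neg, ENNReal.rpow_neg]; gcongr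
  · rw [ENNReal.rpow_neg, ENNReal.rpow_neg]; gcongr

lemma rpow_shift {x R : ℝ≥0∞} {s t : ℝ} (hx : x ≠ ⊤) (hxR : x ≤ R) (hR : R ≠ 0)
    (hs : 0 < s) (ht : 0 ≤ t) : x ^ (-s + t) ≤ R ^ t * x ^ (-s) := by
  rcases eq_or_ne x 0 with rfl | h0
  · rw [ENNReal.zero_rpow_of_neg (by linarith : -s < 0), ENNReal.mul_top]
    · exact le_top
    · intro h
      rw [ENNReal.rpow_eq_zero_iff] at h
      rcases h with h | h
      · exact hR h.1
      · linarith
  · rw [ENNReal.rpow_add _ _ h0 hx, mul_comm]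
    gcongr

lemma Beval_shift (k : ℕ) (c : ℕ → ℝ) (x : ℝ) :
    Beval (shiftSeq k c) x = x ^ k * Beval c x := by
  unfold Beval
  rw [← tsum_mul_left]
  rw [← (add_left_injective k).tsum_eq]
  · refine tsum_congr fun n => ?_
    simp [shiftSeq, pow_add]; ring
  · intro n hn
    rw [Function.mem_support] at hn
    by_cases h : n < k
    · simp [shiftSeq, h] at hn
    · exact ⟨n - k, by simp; omega⟩

lemma summable_of_bdd {c : ℕ → ℝ} {A x : ℝ} (hc : ∀ n, |c n| ≤ A) (hx0 : 0 ≤ x) (hx : x < 1) :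
    Summable (fun n => c n * x ^ n) := by
  refine Summable.of_norm_bounded ((summable_geometric_of_lt_one hx0 hx).mul_left A) fun n => ?_
  rw [norm_mul, norm_pow, Real.norm_eq_abs, Real.norm_eq_abs, abs_of_nonneg hx0]
  gcongr; exact hc n

lemma Beval_le {c : ℕ → ℝ} {A x : ℝ} (hc : ∀ n, |c n| ≤ A) (hx0 : 0 ≤ x) (hx : x < 1) :
    |Beval c x| ≤ A * (1 - x)⁻¹ := by
  rw [← Real.norm_eq_abs]
  unfold Beval
  refine tsum_of_norm_bounded ((hasSum_geometric_of_lt_one hx0 hx).mul_left A) fun n => ?_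
  rw [norm_mul, norm_pow, Real.norm_eq_abs, Real.norm_eq_abs, abs_of_nonneg hx0]
  gcongr; exact hc n

/-- A measurable version of `|Beval · x|`. -/
def Ymeas (x : ℝ) (ω : ℕ → ℝ) : ℝ≥0∞ :=
  liminf (fun n : ℕ => ENNReal.ofReal |∑ i ∈ Finset.range n, ω i * x ^ i|) atTop

lemma measurable_Ymeas (x : ℝ) : Measurable (Ymeas x) := by
  unfold Ymeas
  refine Measurable.liminf fun n => ?_
  fun_prop

lemma Ymeas_eq {x : ℝ} {ω : ℕ → ℝ} (h : Summable (fun n => ω n * x ^ n)) :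
    Ymeas x ω = ENNReal.ofReal |Beval ω x| := by
  apply Tendsto.liminf_eq
  exact (ENNReal.continuous_ofReal.comp continuous_abs).continuousAt.tendsto.comp
    h.hasSum.tendsto_sum_nat

section Cyl

variable {α : Type*} [Fintype α] [MeasurableSpace α] [MeasurableSingletonClass α]

def cyl (n : ℕ) (w : Fin n → α) : Set (ℕ → α) := {ω | ∀ i : Fin n, ω i.1 = w i}

lemma measurableSet_cyl (n : ℕ) (w : Fin n → α) : MeasurableSet (cyl n w) := by
  have : cyl n w = ⋂ i : Fin n, (fun ω : ℕ → α => ω i.1) ⁻¹' {w i} := by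
    ext; simp [cyl]
  rw [this]
  exact MeasurableSet.iInter fun i => (measurable_pi_apply _) (measurableSet_singleton _)

lemma ext_cyl_s3 (μ ν : Measure (ℕ → α)) [IsFiniteMeasure μ]
    (h : ∀ n (w : Fin n → α), μ (cyl n w) = ν (cyl n w)) : μ = ν := by
  refine ext_of_generate_finite {s | ∃ n, ∃ w : Fin n → α, s = cyl n w} ?_ ?_ ?_ ?_
  · apply le_antisymm
    · refine iSup_le fun i => ?_
      rintro s ⟨t, ht, rfl⟩
      have : (fun b : ℕ → α => b i) ⁻¹' t =
          ⋃ w : {w : Fin (i+1) → α // w (Fin.last i) ∈ t}, cyl (i+1) w.1 := by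
        ext ω
        simp only [mem_preimage, mem_iUnion, cyl, mem_ofPred_eq]
        constructor
        · intro hω
          exact ⟨⟨fun j => ω j.1, by simpa using hω⟩, fun j => rfl⟩
        · rintro ⟨⟨w, hw⟩, hω⟩
          have := hω (Fin.last i)
          simp at this
          rw [this]; exact hw
      change MeasurableSet[MeasurableSpace.generateFrom {s | ∃ n, ∃ w : Fin n → α, s = cyl n w}] ((fun b : ℕ → α => b i) ⁻¹' t)
      rw [this]
      have := Finite.of_fintype α
      refine @MeasurableSet.iUnion _ _ (MeasurableSpace.generateFrom _) _ _ fun w => ?_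
      exact MeasurableSpace.measurableSet_generateFrom ⟨_, _, rfl⟩
    · refine MeasurableSpace.generateFrom_le ?_
      rintro s ⟨n, w, rfl⟩
      exact measurableSet_cyl n w
  · have key : ∀ n n' (w : Fin n → α) (w' : Fin n' → α), n ≤ n' →
        (cyl n w ∩ cyl n' w').Nonempty → cyl n w ∩ cyl n' w' = cyl n' w' := by
      rintro n n' w w' hn ⟨ω, h1, h2⟩
      refine inter_eq_right.2 fun ω' h' i => ?_
      have e1 := h1 i
      have e2 := h2 ⟨i.1, by omega⟩
      have e3 := h' ⟨i.1, by omega⟩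
      simp only at e2 e3
      rw [e3, ← e2, e1]
    rintro s ⟨n, w, rfl⟩ t ⟨n', w', rfl⟩ hne
    rcases le_total n n' with hn | hn
    · exact ⟨n', w', key _ _ _ _ hn hne⟩
    · rw [inter_comm] at hne ⊢
      exact ⟨n, w, key _ _ _ _ hn hne⟩
  · rintro s ⟨n, w, rfl⟩; exact h n w
  · have e := h 0 (fun i => i.elim0)
    simpa [cyl] using e

def sh (k : ℕ) (ω : ℕ → α) : ℕ → α := fun n => ω (n + k)

lemma measurable_sh (k : ℕ) : Measurable (sh k : (ℕ → α) → ℕ → α) :=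
  measurable_pi_lambda _ fun _ => measurable_pi_apply _

lemma shift_cyl (c : ℝ≥0∞) (ρ : Measure (ℕ → α)) (hρ : IsBernoulliWith (fun _ => c) ρ)
    (k : ℕ) (w : Fin k → α) :
    (ρ.restrict (cyl k w)).map (sh k) = c ^ k • ρ := by
  have := hρ.1
  apply ext_cyl_s3
  intro n v
  rw [Measure.map_apply (measurable_sh k) (measurableSet_cyl n v),
    Measure.restrict_apply (measurable_sh k (measurableSet_cyl n v))]
  have e : sh k ⁻¹' cyl n v ∩ cyl k w = {ω | ∀ i : Fin (k + n), ω i.1 = Fin.append w v i} := by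
    ext ω
    simp only [mem_inter_iff, mem_preimage, cyl, sh, mem_ofPred_eq]
    constructor
    · rintro ⟨h1, h2⟩ i
      refine Fin.addCases (fun j => ?_) (fun j => ?_) i
      · simpa using h2 j
      · simpa [add_comm] using h1 j
    · intro h
      constructor
      · intro j; simpa [add_comm] using h (Fin.natAdd k j)
      · intro j; simpa using h (Fin.castAdd n j)
  rw [e, hρ.2, Measure.smul_apply]
  have := hρ.2 n v
  rw [cyl, this]
  simp [pow_add]

end Cyl

lemma prefix_integral (m : ℕ) (hm : 2 ≤ m) (ρ : Measure (ℕ → Fin m))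
    (hρ : IsBernoulliWith (fun _ => (m : ℝ≥0∞)⁻¹) ρ) (k : ℕ)
    (h : (ℕ → Fin m) × (ℕ → Fin m) → ℝ≥0∞) (hh : Measurable h) :
    ∫⁻ q in {q : (ℕ → Fin m) × (ℕ → Fin m) | ∀ i < k, q.1 i = q.2 i},
      h (Prod.map (sh k) (sh k) q) ∂(ρ.prod ρ)
      ≤ ((m : ℝ≥0∞)⁻¹) ^ k * ∫⁻ q, h q ∂(ρ.prod ρ) := by
  have := hρ.1
  have hE : {q : (ℕ → Fin m) × (ℕ → Fin m) | ∀ i < k, q.1 i = q.2 i} =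
      ⋃ w : Fin k → Fin m, cyl k w ×ˢ cyl k w := by
    ext q
    simp only [mem_iUnion, mem_prod, cyl, mem_ofPred_eq]
    constructor
    · intro hq
      exact ⟨fun j => q.1 j.1, fun j => rfl, fun j => (hq _ j.2).symm⟩
    · rintro ⟨w, h1, h2⟩ i hi
      have e1 := h1 ⟨i, hi⟩
      have e2 := h2 ⟨i, hi⟩
      simp only at e1 e2
      rw [e1, e2]
  rw [hE]
  refine (lintegral_iUnion_le _ _).trans ?_
  have hterm : ∀ w : Fin k → Fin m, ∫⁻ q in cyl k w ×ˢ cyl k w,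
      h (Prod.map (sh k) (sh k) q) ∂(ρ.prod ρ)
      = ((m : ℝ≥0∞)⁻¹) ^ k * (((m : ℝ≥0∞)⁻¹) ^ k * ∫⁻ q, h q ∂(ρ.prod ρ)) := by
    intro w
    rw [← Measure.prod_restrict,
      ← lintegral_map hh ((measurable_sh k).prodMap (measurable_sh k)),
      ← Measure.map_prod_map _ _ (measurable_sh k) (measurable_sh k),
      shift_cyl _ ρ hρ k w, Measure.prod_smul_left, Measure.prod_smul_right,
      lintegral_smul_measure, lintegral_smul_measure]
    rfl
  simp_rw [hterm]
  rw [tsum_fintype, Finset.sum_const, nsmul_eq_mul]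
  rw [← mul_assoc]
  have : ((Finset.univ : Finset (Fin k → Fin m)).card : ℝ≥0∞) * ((m : ℝ≥0∞)⁻¹) ^ k = 1 := by
    simp only [Finset.card_univ, Fintype.card_fun, Fintype.card_fin, Nat.cast_pow]
    rw [← mul_pow, ENNReal.mul_inv_cancel, one_pow]
    · simp; omega
    · simp
  rw [this, one_mul]

/-- coordinatewise difference -/
def dif (m : ℕ) (d : Fin m → ℝ) (q : (ℕ → Fin m) × (ℕ → Fin m)) : ℕ → ℝ :=
  fun n => d (q.1 n) - d (q.2 n)

lemma measurable_dif (m : ℕ) (d : Fin m → ℝ) : Measurable (dif m d) := by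
  have hd : Measurable d := measurable_of_finite d
  refine measurable_pi_lambda _ fun n => ?_
  exact (hd.comp ((measurable_pi_apply n).comp measurable_fst)).sub
    (hd.comp ((measurable_pi_apply n).comp measurable_snd))

lemma dif_bdd (m : ℕ) (d : Fin m → ℝ) : ∃ A : ℝ, 0 ≤ A ∧ ∀ i j, |d i - d j| ≤ A := by
  obtain ⟨A, hA⟩ := (Set.finite_range (fun p : Fin m × Fin m => |d p.1 - d p.2|)).bddAbove
  exact ⟨max A 0, le_max_right _ _, fun i j => (hA ⟨(i,j), rfl⟩).trans (le_max_left _ _)⟩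

lemma memBtilde_shift {m : ℕ} (hm : 2 ≤ m) {d : Fin m → ℝ} {c : ℕ → ℝ} (k : ℕ)
    (hc : memBtilde m d c) : memBtilde m d (shiftSeq k c) := by
  intro n
  unfold shiftSeq
  split_ifs
  · exact ⟨⟨0, by omega⟩, ⟨0, by omega⟩, by simp⟩
  · exact hc _

lemma Beval_dif (m : ℕ) (d : Fin m → ℝ) {l : ℝ} (h0 : 0 ≤ l) (h1 : l < 1)
    (q : (ℕ → Fin m) × (ℕ → Fin m)) :
    Beval (dif m d q) l = PiOne m d l q.1 - PiOne m d l q.2 := by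
  obtain ⟨A, hA⟩ := (Set.finite_range (fun p : Fin m => |d p|)).bddAbove
  have hs : ∀ ω : ℕ → Fin m, Summable (fun n => d (ω n) * l ^ n) := fun ω =>
    summable_of_bdd (c := fun n => d (ω n)) (fun n => hA ⟨ω n, rfl⟩) h0 h1
  unfold Beval PiOne dif
  rw [← (hs _).tsum_sub (hs _)]
  exact tsum_congr fun n => by ring

lemma measurable_PiOne (m : ℕ) (d : Fin m → ℝ) {l : ℝ} (h0 : 0 ≤ l) (h1 : l < 1) :
    Measurable (PiOne m d l) := by
  obtain ⟨A, hA⟩ := (Set.finite_range (fun p : Fin m => |d p|)).bddAbove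
  have hs : ∀ ω : ℕ → Fin m, Summable (fun n => d (ω n) * l ^ n) := fun ω =>
    summable_of_bdd (c := fun n => d (ω n)) (fun n => hA ⟨ω n, rfl⟩) h0 h1
  have hd : Measurable d := measurable_of_finite d
  refine measurable_of_tendsto_metrizable
    (f := fun n ω => ∑ i ∈ Finset.range n, d (ω i) * l ^ i) (fun n => ?_) ?_
  · refine Finset.measurable_sum _ fun i _ => ?_
    exact (hd.comp (measurable_pi_apply i)).mul_const _
  · rw [tendsto_pi_nhds]
    exact fun ω => (hs ω).hasSum.tendsto_sum_nat

lemma corr_moment (m : ℕ) (d : Fin m → ℝ) {l : ℝ} (h0 : 0 ≤ l) (h1 : l < 1)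
    (ρ : Measure (ℕ → Fin m)) [IsProbabilityMeasure ρ] (K ξ p : ℝ)
    (hcorr : ∀ r : ℝ, 0 < r →
      ((ρ.map (PiOne m d l)).prod (ρ.map (PiOne m d l)))
          {p : ℝ × ℝ | |p.1 - p.2| ≤ r} ≤ ENNReal.ofReal (K * r ^ (1 - ξ)))
    (hp0 : 0 ≤ p) (hp : p = 0 ∨ p < 1 - ξ) :
    ∫⁻ q, ENNReal.ofReal |Beval (dif m d q) l| ^ (-p) ∂(ρ.prod ρ) < ⊤ := by
  rcases hp with rfl | hp
  · simp
  · have hmeas := measurable_PiOne m d h0 h1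
    refine (neg_moment (ρ.prod ρ) (fun q => |Beval (dif m d q) l|) K (1 - ξ) p hp0 ?_).trans_lt ?_
    · intro r hr
      have := hcorr r hr
      rw [Measure.map_prod_map _ _ hmeas hmeas, Measure.map_apply (hmeas.prodMap hmeas)] at this
      · simpa [Beval_dif m d h0 h1] using this
      · exact measurableSet_le (by fun_prop) measurable_const
    · exact ENNReal.add_lt_top.2 ⟨measure_lt_top _ _, neg_moment_const K _ _ hp⟩

lemma prefix_moment (m : ℕ) (hm : 2 ≤ m) (d : Fin m → ℝ) {l : ℝ} (h0 : 0 < l) (h1 : l < 1)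
    (ρ : Measure (ℕ → Fin m)) (hρ : IsBernoulliWith (fun _ => (m : ℝ≥0∞)⁻¹) ρ) (p : ℝ) (k : ℕ)
    (hd : StrictMono d) :
    ∫⁻ ω in {ω : ℕ → ℝ | ∀ i < k, ω i = 0}, Ymeas l ω ^ (-p) ∂(etaMeasure m d ρ)
      ≤ (ENNReal.ofReal l ^ (-p) * (m : ℝ≥0∞)⁻¹) ^ k *
        ∫⁻ q, ENNReal.ofReal |Beval (dif m d q) l| ^ (-p) ∂(ρ.prod ρ) := by
  have := hρ.1
  obtain ⟨A, hA0, hA⟩ := dif_bdd m d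
  have hsum : ∀ q, Summable (fun n => dif m d q n * l ^ n) := fun q =>
    summable_of_bdd (fun n => hA _ _) h0.le h1
  have hY : ∀ q, Ymeas l (dif m d q) = ENNReal.ofReal |Beval (dif m d q) l| :=
    fun q => Ymeas_eq (hsum q)
  have hmd := measurable_dif m d
  have hZ : MeasurableSet {ω : ℕ → ℝ | ∀ i < k, ω i = 0} := by
    have : {ω : ℕ → ℝ | ∀ i < k, ω i = 0} = ⋂ i, ⋂ (_ : i < k), (fun ω : ℕ → ℝ => ω i) ⁻¹' {0} := by
      ext; simp
    rw [this]
    exact MeasurableSet.iInter fun i => MeasurableSet.iInter fun _ =>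
      measurable_pi_apply i (measurableSet_singleton _)
  have hYm : Measurable fun ω => Ymeas l ω ^ (-p) := (measurable_Ymeas l).pow_const _
  have e : etaMeasure m d ρ = (ρ.prod ρ).map (dif m d) := rfl
  rw [e, setLIntegral_map hZ hYm hmd]
  have hpre : dif m d ⁻¹' {ω : ℕ → ℝ | ∀ i < k, ω i = 0}
      = {q : (ℕ → Fin m) × (ℕ → Fin m) | ∀ i < k, q.1 i = q.2 i} := by
    ext q
    simp [dif, sub_eq_zero, hd.injective.eq_iff]
  have hhm : Measurable fun q => ENNReal.ofReal |Beval (dif m d q) l| ^ (-p) := by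
    simp_rw [← hY]; exact hYm.comp hmd
  have hb : ∀ q ∈ dif m d ⁻¹' {ω : ℕ → ℝ | ∀ i < k, ω i = 0},
      Ymeas l (dif m d q) ^ (-p) = (ENNReal.ofReal l ^ (-p)) ^ k *
        (fun q => ENNReal.ofReal |Beval (dif m d q) l| ^ (-p)) (Prod.map (sh k) (sh k) q) := by
    intro q hq
    have es : dif m d q = shiftSeq k (dif m d (Prod.map (sh k) (sh k) q)) := by
      ext n
      unfold shiftSeq
      split_ifs with hn
      · exact hq n hn
      · simp [dif, sh, Nat.sub_add_cancel (not_lt.1 hn)]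
    rw [hY]
    conv_lhs => rw [es, Beval_shift]
    rw [abs_mul, abs_pow, abs_of_pos h0, ENNReal.ofReal_mul (by positivity),
      ENNReal.ofReal_pow h0.le, ENNReal.mul_rpow_of_ne_top (by simp) (by simp),
      ← ENNReal.rpow_natCast, ← ENNReal.rpow_natCast, ← ENNReal.rpow_mul, ← ENNReal.rpow_mul,
      mul_comm (k : ℝ)]
  rw [setLIntegral_congr_fun (hmd hZ) hb, hpre, lintegral_const_mul, mul_pow, mul_assoc]
  · gcongr
    exact prefix_integral m hm ρ hρ k _ hhm
  · exact hhm.comp ((measurable_sh k).prodMap (measurable_sh k))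

/-- Key estimate: under a correlation bound for `ν_{λ₀}` and transversality of `J₁` for
`𝓑̃′ = ⋃ₖ x^k 𝓑′`, the double integral `∫_{𝓑̃′} ∫_{J₁} |Π_{γ,λ₀}(ω)|^{−Dim+ε} dγ dη(ω)`
is finite, where `Dim = 1 + log(m λ₀)/log(1/γ₀)` and `γ₀ = min J₁`. -/
theorem key_integral_estimate
    (m : ℕ) (hm : 2 ≤ m) (d : Fin m → ℝ) (hd0 : d ⟨0, by omega⟩ = 0) (hd : StrictMono d)
    (ρ : Measure (ℕ → Fin m)) (hρ : IsBernoulliWith (fun _ => (m : ℝ≥0∞)⁻¹) ρ)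
    (a1 b1 a2 b2 : ℝ) (h1 : a1 < b1) (h2 : a2 < b2)
    (hΓ : Icc a1 b1 ×ˢ Icc a2 b2 ⊆ Gamma m 0 (1 / m))
    (ξ ε : ℝ) (hξ : 0 < ξ) (hξε : ξ < ε)
    (l0 : ℝ) (hl0 : l0 ∈ Icc a2 b2) (K : ℝ) (hK : 0 < K)
    (hcorr : ∀ r : ℝ, 0 < r →
      ((ρ.map (PiOne m d l0)).prod (ρ.map (PiOne m d l0)))
          {p : ℝ × ℝ | |p.1 - p.2| ≤ r} ≤ ENNReal.ofReal (K * r ^ (1 - ξ)))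
    (B' : Set (ℕ → ℝ)) (hB' : ∀ c ∈ B', memB m d c)
    (htr : IsTransvOn (Icc a1 b1) B') :
    ∫⁻ ω in ⋃ k, shiftSeq k '' B',
      (∫⁻ g in Icc a1 b1,
        ENNReal.ofReal (Real.sqrt (Beval ω g ^ 2 + Beval ω l0 ^ 2)) ^
          (-(1 + Real.log (m * l0) / Real.log (1 / a1)) + ε))
      ∂(etaMeasure m d ρ) < ⊤ := by
  obtain ⟨M, hM, htr⟩ := htr
  have hG : ∀ g ∈ Icc a1 b1, 0 < g ∧ g < l0 ∧ l0 < 1 ∧ 1 / (m : ℝ) < l0 ∧ 0 < g * l0 ∧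
      g * l0 < 1 / m := fun g hg => hΓ (show (g, l0) ∈ _ from ⟨hg, hl0⟩)
  have ha1 : a1 ∈ Icc a1 b1 := ⟨le_rfl, h1.le⟩
  obtain ⟨ha0, hal, hl1, hml, -, hal2⟩ := hG a1 ha1
  have hm0 : (0 : ℝ) < m := by exact_mod_cast (by omega : 0 < m)
  have hl00 : 0 < l0 := ha0.trans hal
  have hml1 : 1 < m * l0 := by
    rw [div_lt_iff₀ hm0] at hml; linarith
  have hml2 : m * l0 < 1 / a1 := by
    rw [lt_div_iff₀ hm0] at hal2
    rw [lt_div_iff₀ ha0]; linarith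
  set δ : ℝ := Real.log (m * l0) / Real.log (1 / a1) with hδ
  have hlog1 : 0 < Real.log (m * l0) := Real.log_pos hml1
  have hlog2 : Real.log (m * l0) < Real.log (1 / a1) := Real.log_lt_log (by linarith) hml2
  have hδ0 : 0 < δ := div_pos hlog1 (by linarith)
  have hδ1 : δ < 1 := (div_lt_one (by linarith)).2 hlog2
  have haδ : a1 ^ (-δ) = m * l0 := by
    rw [Real.rpow_def_of_pos ha0]
    have : Real.log a1 * -δ = Real.log (m * l0) := by
      have h3 : Real.log a1 = - Real.log (1 / a1) := by rw [one_div, Real.log_inv]; ring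
      rw [hδ, h3]
      have : Real.log (1 / a1) ≠ 0 := by linarith
      field_simp
    rw [this, Real.exp_log (by linarith)]
  set q : ℝ := min 1 ε with hq
  have hq0 : 0 < q := lt_min one_pos (hξ.trans hξε)
  have hq1 : q ≤ 1 := min_le_left _ _
  have hqε : q ≤ ε := min_le_right _ _
  set p : ℝ := 1 - q with hp
  have hp0 : 0 ≤ p := by linarith
  have hpξ : p = 0 ∨ p < 1 - ξ := by
    rcases le_total 1 ε with h | h
    · left; rw [hp, hq, min_eq_left h]; ring
    · right; rw [hp, hq, min_eq_right h]; linarith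
  have := hρ.1
  obtain ⟨A, hA0, hA⟩ := dif_bdd m d
  have hbd : ∀ c, memBtilde m d c → ∀ n, |c n| ≤ A := by
    intro c hc n
    obtain ⟨i, j, hij⟩ := hc n
    rw [hij]; exact hA i j
  -- the uniform bound on the norm
  set R : ℝ := 2 * (A * (1 - l0)⁻¹) + 1 with hR
  have hR0 : 0 < R := by
    have : 0 ≤ (1 - l0)⁻¹ := inv_nonneg.2 (by linarith)
    positivity
  -- transversality constant
  set C : ℝ≥0∞ := volume (Icc a1 b1) +
      ∑' n : ℕ, ENNReal.ofReal ((2:ℝ) ^ (δ * (n + 1)))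
        * ENNReal.ofReal (2 * M * ((1/2:ℝ) ^ n) ^ (1:ℝ)) with hC
  have hCtop : C < ⊤ := ENNReal.add_lt_top.2
    ⟨isCompact_Icc.measure_lt_top, neg_moment_const (2 * M) 1 δ hδ1⟩
  have htrans : ∀ c ∈ B', ∫⁻ g in Icc a1 b1, ENNReal.ofReal |Beval c g| ^ (-δ) ≤ C := by
    intro c hc
    have := neg_moment (volume.restrict (Icc a1 b1)) (fun g => |Beval c g|) (2 * M) 1 δ hδ0.le ?_
    · rwa [Measure.restrict_apply_univ] at this
    · intro r hr
      rw [Measure.restrict_apply' measurableSet_Icc]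
      refine (measure_mono ?_).trans ((htr c hc (2 * r) (by linarith)).le.trans_eq ?_)
      · rintro g ⟨hg1, hg2⟩
        simp only [mem_ofPred_eq] at hg1
        exact ⟨hg2, by linarith⟩
      · rw [Real.rpow_one]; congr 1; ring
  -- pointwise bound on the k-th piece
  have hpiece : ∀ k, ∀ ω ∈ shiftSeq k '' B',
      (∫⁻ g in Icc a1 b1, ENNReal.ofReal (Real.sqrt (Beval ω g ^ 2 + Beval ω l0 ^ 2)) ^
          (-(1 + δ) + ε)) ≤
      (ENNReal.ofReal R ^ (ε - q) * C * ENNReal.ofReal (m * l0) ^ k) * Ymeas l0 ω ^ (-p) := by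
    rintro k _ ⟨c, hc, rfl⟩
    have hcB := (hB' c hc).1
    have hsB := hbd _ (memBtilde_shift hm k hcB)
    rw [Ymeas_eq (summable_of_bdd hsB hl00.le hl1)]
    set y := ENNReal.ofReal |Beval (shiftSeq k c) l0| with hy
    have hpt : ∀ g ∈ Icc a1 b1,
        ENNReal.ofReal (Real.sqrt (Beval (shiftSeq k c) g ^ 2 + Beval (shiftSeq k c) l0 ^ 2)) ^
          (-(1 + δ) + ε) ≤
        (ENNReal.ofReal R ^ (ε - q) * ENNReal.ofReal (m * l0) ^ k * y ^ (-p)) *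
          ENNReal.ofReal |Beval c g| ^ (-δ) := by
      intro g hg
      obtain ⟨hg0, hgl, -⟩ := hG g hg
      set u := Beval (shiftSeq k c) g with hu
      set v := Beval (shiftSeq k c) l0 with hv
      have hu1 : |u| ≤ A * (1 - l0)⁻¹ := by
        refine (Beval_le hsB hg0.le (hgl.trans hl1)).trans ?_
        have : (1 - g)⁻¹ ≤ (1 - l0)⁻¹ := inv_anti₀ (by linarith) (by linarith)
        gcongr
      have hv1 : |v| ≤ A * (1 - l0)⁻¹ := Beval_le hsB hl00.le hl1
      have hsq : Real.sqrt (u ^ 2 + v ^ 2) ≤ R := by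
        rw [Real.sqrt_le_left hR0.le]
        have : u ^ 2 + v ^ 2 ≤ (|u| + |v|) ^ 2 := by
          rw [← sq_abs u, ← sq_abs v]; nlinarith [abs_nonneg u, abs_nonneg v]
        refine this.trans ?_
        gcongr
        linarith
      set x := ENNReal.ofReal (Real.sqrt (u ^ 2 + v ^ 2)) with hx
      have hux : ENNReal.ofReal (a1 ^ k * |Beval c g|) ≤ x := by
        apply ENNReal.ofReal_le_ofReal
        apply Real.le_sqrt_of_sq_le
        have : a1 ^ k * |Beval c g| ≤ |u| := by
          rw [hu, Beval_shift, abs_mul, abs_pow, abs_of_pos hg0]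
          gcongr
          exact hg.1
        calc (a1 ^ k * |Beval c g|) ^ 2 ≤ |u| ^ 2 := by gcongr
          _ = u ^ 2 := sq_abs u
          _ ≤ _ := by nlinarith [sq_nonneg v]
      have hyx : y ≤ x := by
        apply ENNReal.ofReal_le_ofReal
        apply Real.le_sqrt_of_sq_le
        rw [sq_abs]; nlinarith [sq_nonneg u]
      have hexp : -(1 + δ) + ε = -(δ + p) + (ε - q) := by rw [hp]; ring
      rw [hexp]
      have e1 : ENNReal.ofReal (a1 ^ k * |Beval c g|) ^ (-δ) =
          ENNReal.ofReal (m * l0) ^ k * ENNReal.ofReal |Beval c g| ^ (-δ) := by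
        rw [ENNReal.ofReal_mul (by positivity), ENNReal.mul_rpow_of_ne_top (by simp) (by simp),
          ENNReal.ofReal_pow ha0.le, ← haδ, ← ENNReal.ofReal_rpow_of_pos ha0,
          ← ENNReal.rpow_natCast, ← ENNReal.rpow_natCast, ← ENNReal.rpow_mul, ← ENNReal.rpow_mul,
          mul_comm (k : ℝ)]
      calc x ^ (-(δ + p) + (ε - q)) ≤ ENNReal.ofReal R ^ (ε - q) * x ^ (-(δ + p)) :=
            rpow_shift ENNReal.ofReal_ne_top (ENNReal.ofReal_le_ofReal hsq)
              (by simpa using hR0) (by linarith) (by linarith)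
        _ ≤ ENNReal.ofReal R ^ (ε - q) *
            (ENNReal.ofReal (a1 ^ k * |Beval c g|) ^ (-δ) * y ^ (-p)) := by
            gcongr
            exact rpow_split ENNReal.ofReal_ne_top hux hyx hδ0.le hp0
        _ = _ := by rw [e1]; ring
    refine (setLIntegral_mono' measurableSet_Icc hpt).trans ?_
    by_cases hy0 : y ^ (-p) = ⊤
    · rw [hy0]
      refine le_top.trans_eq (ENNReal.mul_top ?_).symm
      · refine mul_ne_zero (mul_ne_zero ?_ ?_) ?_
        · exact (ENNReal.rpow_pos (by simpa using hR0) ENNReal.ofReal_ne_top).ne'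
        · have : 0 < volume (Icc a1 b1) := by rw [Real.volume_Icc]; simpa using h1
          exact (this.trans_le le_self_add).ne'
        · exact pow_ne_zero _ (ENNReal.ofReal_pos.2 (by linarith)).ne'
    · rw [lintegral_const_mul']
      · refine (mul_le_mul' le_rfl (htrans c hc)).trans_eq ?_
        ring
      · refine ENNReal.mul_ne_top (ENNReal.mul_ne_top ?_ (ENNReal.pow_ne_top ENNReal.ofReal_ne_top)) hy0
        exact ENNReal.rpow_ne_top_of_nonneg (by linarith) ENNReal.ofReal_ne_top
  -- summation
  set I := ∫⁻ q, ENNReal.ofReal |Beval (dif m d q) l0| ^ (-p) ∂(ρ.prod ρ) with hI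
  have hIfin : I < ⊤ := corr_moment m d hl00.le hl1 ρ K ξ p hcorr hp0 hpξ
  set C2 : ℝ≥0∞ := ENNReal.ofReal R ^ (ε - q) * C with hC2
  have hC2fin : C2 < ⊤ := ENNReal.mul_lt_top
    (ENNReal.rpow_ne_top_of_nonneg (by linarith) ENNReal.ofReal_ne_top).lt_top hCtop
  have hratio : ENNReal.ofReal (m * l0) * (ENNReal.ofReal l0 ^ (-p) * (m : ℝ≥0∞)⁻¹)
      = ENNReal.ofReal (l0 ^ q) := by
    have : (m : ℝ≥0∞)⁻¹ = ENNReal.ofReal ((m : ℝ)⁻¹) := by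
      rw [ENNReal.ofReal_inv_of_pos hm0, ENNReal.ofReal_natCast]
    rw [this, ENNReal.ofReal_rpow_of_pos hl00, ← ENNReal.ofReal_mul (by positivity),
      ← ENNReal.ofReal_mul (by positivity)]
    congr 1
    have : l0 ^ q = l0 * l0 ^ (-p) := by
      rw [show q = 1 + -p by rw [hp]; ring, Real.rpow_add hl00, Real.rpow_one]
    rw [this]; field_simp
  have hterm : ∀ k, ∫⁻ ω in shiftSeq k '' B',
      (∫⁻ g in Icc a1 b1, ENNReal.ofReal (Real.sqrt (Beval ω g ^ 2 + Beval ω l0 ^ 2)) ^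
          (-(1 + δ) + ε)) ∂(etaMeasure m d ρ) ≤ C2 * I * ENNReal.ofReal (l0 ^ q) ^ k := by
    intro k
    have hYm : Measurable fun ω => Ymeas l0 ω ^ (-p) := (measurable_Ymeas l0).pow_const _
    refine (setLIntegral_mono (hYm.const_mul _) (hpiece k)).trans ?_
    rw [lintegral_const_mul _ hYm]
    have hsub : shiftSeq k '' B' ⊆ {ω : ℕ → ℝ | ∀ i < k, ω i = 0} := by
      rintro _ ⟨c, -, rfl⟩ i hi
      simp [shiftSeq, hi]
    calc _ ≤ C2 * ENNReal.ofReal (m * l0) ^ k *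
          ((ENNReal.ofReal l0 ^ (-p) * (m : ℝ≥0∞)⁻¹) ^ k * I) := by
            gcongr
            exact (lintegral_mono_set hsub).trans (prefix_moment m hm d hl00 hl1 ρ hρ p k hd)
      _ = _ := by rw [← hratio, mul_pow]; ring
  refine (lintegral_iUnion_le _ _).trans_lt ((ENNReal.tsum_le_tsum hterm).trans_lt ?_)
  rw [ENNReal.tsum_mul_left, ENNReal.tsum_geometric]
  refine ENNReal.mul_lt_top (ENNReal.mul_lt_top hC2fin hIfin) ?_
  rw [ENNReal.inv_lt_top, tsub_pos_iff_lt, ENNReal.ofReal_lt_one]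
  exact Real.rpow_lt_one hl00.le hl1 hq0
end
end
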